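/- arXiv:1711.09359 — 5 statements merged into one kernel-verified Lean document; each statement's English description precedes it below -/
import Mathlib

section
/- For every T > 0 there exist a bounded linear operator Υ : L²₀(𝕋²) × L²₀(𝕋²) → L²((0,T); L²(𝕋²)) and a constant C > 0 such that for all u₀, u₁ ∈ L²₀(𝕋²), the control h := Υ(u₀,u₁) satisfies S(T)u₀ + ∫₀ᵀ S(T−s)(𝒢⊥(h(s))) ds = u₁, and moreover ‖Υ(u₀,u₁)‖_{L²((0,T);L²(𝕋²))} ≤ C (‖u₀‖_{L²(𝕋²)} + ‖u₁‖_{L²(𝕋²)}). -/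
open MeasureTheory Real Filter

noncomputable section

instance : Fact (0 < 2 * Real.pi) := ⟨by positivity⟩

/-- The torus `𝕋 = ℝ/2πℤ`. -/
abbrev Torus := AddCircle (2 * Real.pi)
/-- The two-dimensional torus `𝕋² = (ℝ/2πℤ)²`. -/
abbrev Torus2 := Torus × Torus

/-- `L²(𝕋)`. -/
abbrev L2T := Lp ℂ 2 (volume : Measure Torus)
/-- `L²(𝕋²)`. -/
abbrev L2T2 := Lp ℂ 2 (volume : Measure Torus2)

/-- 2D Fourier coefficient `û(k,l) = (1/4π²) ∫_{𝕋²} u(x,y) e^{-i(kx+ly)} dx dy`. -/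
def fc2 (u : Torus2 → ℂ) (k l : ℤ) : ℂ :=
  (1 / (4 * Real.pi ^ 2)) * ∫ p : Torus2, fourier (-k) p.1 * fourier (-l) p.2 * u p

/-- Membership in `L²₀(𝕋²)`: all Fourier coefficients `û(0,l)` vanish. -/
def MeanZero2 (u : L2T2) : Prop := ∀ l : ℤ, fc2 (u : Torus2 → ℂ) 0 l = 0

/-- The multiplier `e^{it(k³ - l²/k)}`. -/
def kpPhase (t : ℝ) (k l : ℤ) : ℂ :=
  Complex.exp (Complex.I * (t : ℂ) * ((k : ℂ) ^ 3 - (l : ℂ) ^ 2 / (k : ℂ)))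

/-- Spectral characterization of the linearized KP-II unitary group `S(t)` on `L²₀(𝕋²)`:
`(S(t)u)^(k,l) = e^{it(k³ - l²/k)} û(k,l)` for `k ≠ 0`, and `S(t)` preserves `L²₀`. -/
def IsKPGroup (S : ℝ → L2T2 →L[ℂ] L2T2) : Prop :=
  ∀ t : ℝ, ∀ u : L2T2, MeanZero2 u →
    MeanZero2 (S t u) ∧
      ∀ k l : ℤ, k ≠ 0 → fc2 (S t u : Torus2 → ℂ) k l = kpPhase t k l * fc2 (u : Torus2 → ℂ) k l

/-- `(𝒢⊥ h)(x,y) = g(x) (h(x,y) - ∫_𝕋 g(x') h(x',y) dx')` (a.e.). -/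
def IsGperp (g : Torus → ℝ) (G : L2T2 →L[ℂ] L2T2) : Prop :=
  ∀ h : L2T2, ∀ᵐ p ∂(volume : Measure Torus2),
    (G h : Torus2 → ℂ) p =
      (g p.1 : ℂ) * ((h : Torus2 → ℂ) p - ∫ x' : Torus, (g x' : ℂ) * (h : Torus2 → ℂ) (x', p.2))

/-- `(𝒢∥ h)(x,y) = g(y) (h(x,y) - ∫_𝕋 g(y') h(x,y') dy')` (a.e.). -/
def IsGpar (g : Torus → ℝ) (G : L2T2 →L[ℂ] L2T2) : Prop :=
  ∀ h : L2T2, ∀ᵐ p ∂(volume : Measure Torus2),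
    (G h : Torus2 → ℂ) p =
      (g p.2 : ℂ) * ((h : Torus2 → ℂ) p - ∫ y' : Torus, (g y' : ℂ) * (h : Torus2 → ℂ) (p.1, y'))

section DiagonalGroup

variable {ι H W : Type*} [NormedAddCommGroup H] [InnerProductSpace ℂ H]
  [NormedAddCommGroup W] [InnerProductSpace ℂ W]

theorem HilbertBasis.ext_inner (b : HilbertBasis ι ℂ H) {u v : H}
    (h : ∀ i, inner ℂ (b i) u = inner ℂ (b i) v) : u = v := by
  apply b.repr.injective
  ext i
  simpa only [HilbertBasis.repr_apply_apply] using h i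

theorem HilbertBasis.hasSum_inner_smul (b : HilbertBasis ι ℂ H) (u : H) :
    HasSum (fun i => inner ℂ (b i) u • b i) u := by
  simpa only [HilbertBasis.repr_apply_apply] using b.hasSum_repr u

theorem HilbertBasis.clm_ext (b : HilbertBasis ι ℂ H) {A B : H →L[ℂ] W}
    (h : ∀ i, A (b i) = B (b i)) : A = B := by
  ext u
  have hA := (b.hasSum_inner_smul u).mapL A
  have hB := (b.hasSum_inner_smul u).mapL B
  simp only [map_smul, h] at hA hB
  exact hA.unique hB

/-- `U` is the unitary group acting diagonally in the basis `b`, with frequencies `ν`. -/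
def IsDiagonalGroup (b : HilbertBasis ι ℂ H) (ν : ι → ℝ) (U : ℝ → H →L[ℂ] H) : Prop :=
  ∀ (t : ℝ) (u : H) (i : ι),
    inner ℂ (b i) (U t u) = Complex.exp (Complex.I * t * ν i) * inner ℂ (b i) u

namespace IsDiagonalGroup

variable {b : HilbertBasis ι ℂ H} {ν : ι → ℝ} {U : ℝ → H →L[ℂ] H}

theorem map_add (hU : IsDiagonalGroup b ν U) (s t : ℝ) (u : H) : U (s + t) u = U s (U t u) := by
  apply b.ext_inner
  intro i
  rw [hU, hU, hU, ← mul_assoc, ← Complex.exp_add]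
  congr 2
  push_cast
  ring

theorem map_zero (hU : IsDiagonalGroup b ν U) (u : H) : U 0 u = u := by
  apply b.ext_inner
  intro i
  rw [hU]
  simp

theorem map_basis (hU : IsDiagonalGroup b ν U) (t : ℝ) (i : ι) :
    U t (b i) = Complex.exp (Complex.I * t * ν i) • b i := by
  classical
  apply b.ext_inner
  intro j
  have := orthonormal_iff_ite.1 b.orthonormal j i
  rw [hU, inner_smul_right, this]
  split_ifs with h
  · rw [h]
  · simp

theorem inner_map_left (hU : IsDiagonalGroup b ν U) (t : ℝ) (u v : H) :
    inner ℂ (U t u) v = inner ℂ u (U (-t) v) := by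
  rw [← b.tsum_inner_mul_inner, ← b.tsum_inner_mul_inner]
  congr 1
  ext i
  rw [hU, ← inner_conj_symm, hU, ← inner_conj_symm u, _root_.map_mul, ← Complex.exp_conj]
  simp only [_root_.map_mul, Complex.conj_I, Complex.conj_ofReal, Complex.ofReal_neg]
  rw [mul_comm (Complex.exp _), mul_assoc]
  congr 3
  ring_nf

theorem norm_map (hU : IsDiagonalGroup b ν U) (t : ℝ) (u : H) : ‖U t u‖ = ‖u‖ := by
  have h : inner ℂ (U t u) (U t u) = inner ℂ u u := by
    rw [hU.inner_map_left, ← hU.map_add, neg_add_cancel, hU.map_zero]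
  rw [inner_self_eq_norm_sq_to_K, inner_self_eq_norm_sq_to_K] at h
  have h' : ‖U t u‖ ^ 2 = ‖u‖ ^ 2 := by exact_mod_cast h
  exact (sq_eq_sq₀ (norm_nonneg _) (norm_nonneg _)).1 h'

theorem continuous_inner (hU : IsDiagonalGroup b ν U) (u : H) :
    Continuous fun t => inner ℂ u (U t u) := by
  have hf : (fun t => inner ℂ u (U t u)) = fun t : ℝ =>
      ∑' i, inner ℂ u (b i) * (Complex.exp (Complex.I * t * ν i) * inner ℂ (b i) u) := by
    ext t
    rw [← b.tsum_inner_mul_inner]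
    simp only [hU t u]
  rw [hf]
  refine continuous_tsum (fun i => by fun_prop) (b.summable_inner_mul_inner u u).norm ?_
  intro i t
  rw [norm_mul, norm_mul, norm_mul]
  have : ‖Complex.exp (Complex.I * t * ν i)‖ = 1 := by
    rw [show Complex.I * t * ν i = ((t * ν i : ℝ) : ℂ) * Complex.I by push_cast; ring]
    exact Complex.norm_exp_ofReal_mul_I _
  rw [this, one_mul]

theorem continuous_orbit (hU : IsDiagonalGroup b ν U) (u : H) : Continuous fun t => U t u := by
  rw [continuous_iff_continuousAt]
  intro s
  have hs : ∀ t, ‖U t u - U s u‖ ^ 2 = 2 * ‖u‖ ^ 2 - 2 * (inner ℂ u (U (t - s) u)).re := by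
    intro t
    have h1 := @norm_sub_sq ℂ H _ _ _ (U t u) (U s u)
    have h2 : inner ℂ (U t u) (U s u) = starRingEnd ℂ (inner ℂ u (U (t - s) u)) := by
      rw [inner_conj_symm, hU.inner_map_left, hU.inner_map_left, ← hU.map_add]
      congr 2
      ring_nf
    rw [h1, h2, hU.norm_map, hU.norm_map]
    simp only [RCLike.re_to_complex, Complex.conj_re]
    ring
  have hc : Continuous fun t => 2 * ‖u‖ ^ 2 - 2 * (inner ℂ u (U (t - s) u)).re :=
    continuous_const.sub (continuous_const.mul (Complex.continuous_re.comp
      ((hU.continuous_inner u).comp (continuous_id.sub continuous_const))))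
  have hlim := hc.tendsto s
  have h0 : 2 * ‖u‖ ^ 2 - 2 * (inner ℂ u (U (s - s) u)).re = 0 := by
    rw [← hs s]; simp
  rw [h0] at hlim
  have h3 : Tendsto (fun t => Real.sqrt (‖U t u - U s u‖ ^ 2)) (nhds s) (nhds 0) := by
    have := (Real.continuous_sqrt.tendsto 0).comp hlim
    rw [Real.sqrt_zero] at this
    refine this.congr fun t => ?_
    simp only [Function.comp, hs]
  rw [ContinuousAt, tendsto_iff_norm_sub_tendsto_zero]
  refine h3.congr fun t => Real.sqrt_sq (norm_nonneg _)

theorem continuous_comp (hU : IsDiagonalGroup b ν U) {f : ℝ → ℝ} {v : ℝ → H}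
    (hf : Continuous f) (hv : Continuous v) : Continuous fun s => U (f s) (v s) := by
  have : Continuous fun p : H × ℝ => U p.2 p.1 := by
    refine continuous_prod_of_continuous_lipschitzWith _ 1 hU.continuous_orbit ?_
    intro t
    refine LipschitzWith.of_dist_le_mul fun x y => ?_
    rw [dist_eq_norm, dist_eq_norm, ← map_sub, hU.norm_map]
    simp
  exact this.comp (hv.prodMk hf)

end IsDiagonalGroup

/-- The observation operator `ψ ↦ (s ↦ G (U s ψ))` on the time interval `(0, T)`. -/
theorem IsDiagonalGroup.exists_observation {b : HilbertBasis ι ℂ H} {ν : ι → ℝ}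
    {U : ℝ → H →L[ℂ] H} (hU : IsDiagonalGroup b ν U) (G : H →L[ℂ] H) (T : ℝ) :
    ∃ O : H →L[ℂ] Lp H 2 (volume.restrict (Set.Ioo (0 : ℝ) T)),
      ∀ ψ, O ψ =ᵐ[volume.restrict (Set.Ioo (0 : ℝ) T)] fun s => G (U s ψ) := by
  have hmem : ∀ ψ, MemLp (fun s => G (U s ψ)) 2 (volume.restrict (Set.Ioo (0 : ℝ) T)) := by
    intro ψ
    refine MemLp.of_bound (G.continuous.comp (hU.continuous_orbit ψ)).aestronglyMeasurable
      (‖G‖ * ‖ψ‖) (ae_of_all _ fun s => ?_)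
    exact (G.le_opNorm _).trans_eq (by rw [hU.norm_map])
  let O : H →ₗ[ℂ] Lp H 2 (volume.restrict (Set.Ioo (0 : ℝ) T)) :=
    { toFun := fun ψ => (hmem ψ).toLp _
      map_add' := fun x y => by
        rw [← MemLp.toLp_add]
        congr 1
        ext s
        simp
      map_smul' := fun c x => by
        rw [RingHom.id_apply, ← MemLp.toLp_const_smul]
        congr 1
        ext s
        simp }
  refine ⟨O.mkContinuous ((measureUnivNNReal (volume.restrict (Set.Ioo (0 : ℝ) T)) : ℝ) ^
    (2 : ENNReal).toReal⁻¹ * ‖G‖) fun ψ => ?_, fun ψ => (hmem ψ).coeFn_toLp⟩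
  rw [mul_assoc]
  refine Lp.norm_le_of_ae_bound (by positivity) ?_
  filter_upwards [(hmem ψ).coeFn_toLp] with s hs
  have : (O ψ : ℝ → H) s = G (U s ψ) := hs
  rw [this]
  exact (G.le_opNorm _).trans_eq (by rw [hU.norm_map])

end DiagonalGroup

section LowerBounds

variable {ι H W : Type*} [NormedAddCommGroup H] [InnerProductSpace ℂ H]
  [NormedAddCommGroup W] [InnerProductSpace ℂ W]

/-- A family whose Gram matrix is diagonally dominant satisfies a lower Riesz inequality. -/
theorem norm_sum_sq_ge_of_diagonally_dominant [DecidableEq ι] (w : ι → W) (F : Finset ι) {d : ℝ}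
    (hdiag : ∀ i ∈ F, d ≤ ‖w i‖ ^ 2)
    (hoff : ∀ i ∈ F, ∑ j ∈ F.erase i, ‖inner ℂ (w i) (w j)‖ ≤ d / 2) (a : ι → ℂ) :
    d / 2 * ∑ i ∈ F, ‖a i‖ ^ 2 ≤ ‖∑ i ∈ F, a i • w i‖ ^ 2 := by
  set V : ι → ι → ℝ := fun i j => ‖inner ℂ (w i) (w j)‖ with hV
  have hsymm : ∀ i j, V i j = V j i := fun i j => norm_inner_symm _ _
  have hexp : ‖∑ i ∈ F, a i • w i‖ ^ 2 =
      ∑ i ∈ F, ∑ j ∈ F, (starRingEnd ℂ (a i) * a j * inner ℂ (w i) (w j)).re := by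
    have h1 : (‖∑ i ∈ F, a i • w i‖ ^ 2 : ℝ) =
        (inner ℂ (∑ i ∈ F, a i • w i) (∑ i ∈ F, a i • w i)).re := by
      rw [inner_self_eq_norm_sq_to_K]
      norm_cast
    rw [h1, sum_inner, Complex.re_sum]
    refine Finset.sum_congr rfl fun i _ => ?_
    rw [inner_sum, Complex.re_sum]
    refine Finset.sum_congr rfl fun j _ => ?_
    rw [inner_smul_left, inner_smul_right]
    congr 1
    ring
  have hsplit : ∀ i ∈ F, ‖a i‖ ^ 2 * ‖w i‖ ^ 2 - ∑ j ∈ F.erase i, ‖a i‖ * ‖a j‖ * V i j ≤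
      ∑ j ∈ F, (starRingEnd ℂ (a i) * a j * inner ℂ (w i) (w j)).re := by
    intro i hi
    rw [← Finset.add_sum_erase F _ hi, sub_eq_add_neg, ← Finset.sum_neg_distrib]
    refine add_le_add (le_of_eq ?_) (Finset.sum_le_sum fun j _ => ?_)
    · rw [inner_self_eq_norm_sq_to_K, Complex.conj_mul']
      rw [← Complex.ofReal_pow, Complex.re_ofReal_mul, ← RCLike.ofReal_pow]
      rfl
    · have := Complex.abs_re_le_norm (starRingEnd ℂ (a i) * a j * inner ℂ (w i) (w j))
      rw [norm_mul, norm_mul, RCLike.norm_conj] at this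
      exact (abs_le.1 this).1
  have hcross : ∑ i ∈ F, ∑ j ∈ F.erase i, ‖a i‖ * ‖a j‖ * V i j ≤
      ∑ i ∈ F, ‖a i‖ ^ 2 * ∑ j ∈ F.erase i, V i j := by
    have h2 : ∀ i j, ‖a i‖ * ‖a j‖ * V i j ≤ ‖a i‖ ^ 2 / 2 * V i j + ‖a j‖ ^ 2 / 2 * V i j := by
      intro i j
      rw [← add_mul]
      refine mul_le_mul_of_nonneg_right ?_ (norm_nonneg _)
      nlinarith [sq_nonneg (‖a i‖ - ‖a j‖)]
    have h3 : ∑ i ∈ F, ∑ j ∈ F.erase i, ‖a j‖ ^ 2 / 2 * V i j =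
        ∑ i ∈ F, ∑ j ∈ F.erase i, ‖a i‖ ^ 2 / 2 * V i j := by
      rw [Finset.sum_comm' (t' := F) (s' := fun j => F.erase j)]
      · refine Finset.sum_congr rfl fun i _ => Finset.sum_congr rfl fun j _ => ?_
        rw [hsymm]
      · intro i j
        simp only [Finset.mem_erase]
        tauto
    calc _ ≤ ∑ i ∈ F, ∑ j ∈ F.erase i, (‖a i‖ ^ 2 / 2 * V i j + ‖a j‖ ^ 2 / 2 * V i j) :=
          Finset.sum_le_sum fun i _ => Finset.sum_le_sum fun j _ => h2 i j
      _ = _ := by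
          simp only [Finset.sum_add_distrib]
          rw [h3, ← Finset.sum_add_distrib]
          refine Finset.sum_congr rfl fun i _ => ?_
          rw [← Finset.mul_sum]
          ring
  rw [hexp]
  refine le_trans ?_ (Finset.sum_le_sum hsplit)
  rw [Finset.sum_sub_distrib]
  refine le_trans ?_ (sub_le_sub_left hcross _)
  rw [← Finset.sum_sub_distrib, Finset.mul_sum]
  refine Finset.sum_le_sum fun i hi => ?_
  rw [← mul_sub, mul_comm]
  refine mul_le_mul_of_nonneg_left ?_ (sq_nonneg _)
  linarith [hdiag i hi, hoff i hi]

/-- A lower Riesz inequality for the images of basis vectors outside `J` gives a lower bound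
on all vectors whose coordinates in `J` vanish. -/
theorem HilbertBasis.lower_bound_of_finset (b : HilbertBasis ι ℂ H) (O : H →L[ℂ] W) (J : Set ι)
    {c : ℝ}
    (h : ∀ F : Finset ι, (∀ i ∈ F, i ∉ J) → ∀ a : ι → ℂ,
      c * ∑ i ∈ F, ‖a i‖ ^ 2 ≤ ‖∑ i ∈ F, a i • O (b i)‖ ^ 2)
    {ψ : H} (hψ : ∀ i ∈ J, inner ℂ (b i) ψ = 0) : c * ‖ψ‖ ^ 2 ≤ ‖O ψ‖ ^ 2 := by
  classical
  have hs := b.hasSum_inner_smul ψ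
  have h1 : Tendsto (fun F : Finset ι => c * ‖∑ i ∈ F, inner ℂ (b i) ψ • b i‖ ^ 2) atTop
      (nhds (c * ‖ψ‖ ^ 2)) := (Tendsto.norm hs).pow 2 |>.const_mul c
  have h2 : Tendsto (fun F : Finset ι => ‖O (∑ i ∈ F, inner ℂ (b i) ψ • b i)‖ ^ 2) atTop
      (nhds (‖O ψ‖ ^ 2)) := (((O.continuous.tendsto ψ).comp hs).norm).pow 2
  refine le_of_tendsto_of_tendsto' h1 h2 fun F => ?_
  have hF : ∑ i ∈ F, inner ℂ (b i) ψ • b i =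
      ∑ i ∈ F.filter (fun i => i ∉ J), inner ℂ (b i) ψ • b i := by
    rw [Finset.sum_filter]
    refine Finset.sum_congr rfl fun i _ => ?_
    split_ifs with hi
    · rw [hψ i hi, zero_smul]
    · rfl
  have hn : ‖∑ i ∈ F.filter (fun i => i ∉ J), inner ℂ (b i) ψ • b i‖ ^ 2 =
      ∑ i ∈ F.filter (fun i => i ∉ J), ‖inner ℂ (b i) ψ‖ ^ 2 := by
    have := b.orthonormal.inner_sum (fun i => inner ℂ (b i) ψ) (fun i => inner ℂ (b i) ψ)
      (F.filter (fun i => i ∉ J))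
    rw [inner_self_eq_norm_sq_to_K] at this
    simp only [Complex.conj_mul'] at this
    exact Complex.ofReal_injective (by push_cast; exact this)
  rw [hF, hn, map_sum]
  simp only [map_smul]
  exact h _ (fun i hi => (Finset.mem_filter.1 hi).2) _

/-- On a coordinate subspace, an injective operator which is bounded below on a subspace of finite
codimension is bounded below. -/
theorem HilbertBasis.bounded_below_of_injective [CompleteSpace H] (b : HilbertBasis ι ℂ H)
    (O : H →L[ℂ] W) (Z : Set ι) (J : Finset ι) (hJZ : ∀ i ∈ J, i ∉ Z) {c : ℝ} (hc : 0 < c)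
    (hlow : ∀ ψ : H, (∀ i ∈ Z, inner ℂ (b i) ψ = 0) → (∀ i ∈ J, inner ℂ (b i) ψ = 0) →
      c * ‖ψ‖ ^ 2 ≤ ‖O ψ‖ ^ 2)
    (hinj : ∀ ψ : H, (∀ i ∈ Z, inner ℂ (b i) ψ = 0) → O ψ = 0 → ψ = 0) :
    ∃ c' : ℝ, 0 < c' ∧ ∀ ψ : H, (∀ i ∈ Z, inner ℂ (b i) ψ = 0) → c' * ‖ψ‖ ^ 2 ≤ ‖O ψ‖ ^ 2 := by
  classical
  by_contra! hcon
  have hseq : ∀ n : ℕ, ∃ ψ : H, (∀ i ∈ Z, inner ℂ (b i) ψ = 0) ∧ ‖ψ‖ = 1 ∧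
      ‖O ψ‖ ^ 2 < 1 / ((n : ℝ) + 1) := by
    intro n
    obtain ⟨ψ, hZ, hψ⟩ := hcon (1 / ((n : ℝ) + 1)) (by positivity)
    have hne : ‖ψ‖ ≠ 0 := by
      intro h0
      rw [norm_eq_zero] at h0
      simp [h0] at hψ
    have hpos : 0 < ‖ψ‖ := lt_of_le_of_ne (norm_nonneg _) hne.symm
    refine ⟨((‖ψ‖⁻¹ : ℝ) : ℂ) • ψ, fun i hi => ?_, ?_, ?_⟩
    · rw [inner_smul_right, hZ i hi, mul_zero]
    · rw [norm_smul, Complex.norm_real, norm_inv, norm_norm, inv_mul_cancel₀ hne]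
    · rw [map_smul, norm_smul, Complex.norm_real, norm_inv, norm_norm, mul_pow, inv_pow,
        inv_mul_lt_iff₀ (by positivity), mul_comm]
      exact hψ
  choose ψ hψZ hψ1 hψO using hseq
  have hO0 : Tendsto (fun n => O (ψ n)) atTop (nhds 0) := by
    rw [tendsto_zero_iff_norm_tendsto_zero]
    have h1 : Tendsto (fun n => ‖O (ψ n)‖ ^ 2) atTop (nhds 0) :=
      squeeze_zero (fun _ => sq_nonneg _) (fun n => (hψO n).le)
        tendsto_one_div_add_atTop_nhds_zero_nat
    have h2 := (Real.continuous_sqrt.tendsto 0).comp h1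
    rw [Real.sqrt_zero] at h2
    exact h2.congr fun n => Real.sqrt_sq (norm_nonneg _)
  -- extract a convergent subsequence of the coordinates in `J`
  obtain ⟨z, -, φ, hφ, hz⟩ := tendsto_subseq_of_bounded
    (s := Metric.closedBall (0 : J → ℂ) 1) Metric.isBounded_closedBall
    (x := fun n (i : J) => inner ℂ (b i) (ψ n)) (fun n => by
      rw [mem_closedBall_zero_iff, pi_norm_le_iff_of_nonneg zero_le_one]
      intro i
      refine (norm_inner_le_norm _ _).trans ?_
      rw [hψ1, b.orthonormal.1, one_mul])
  set p : (J → ℂ) → H := fun z => ∑ i : J, z i • b i with hp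
  have hpc : Continuous p := by fun_prop
  have hpin : ∀ (z : J → ℂ) (j : ι), inner ℂ (b j) (p z) = if h : j ∈ J then z ⟨j, h⟩ else 0 := by
    intro z j
    simp only [hp, inner_sum, inner_smul_right, orthonormal_iff_ite.1 b.orthonormal]
    split_ifs with h
    · rw [Finset.sum_eq_single ⟨j, h⟩]
      · simp
      · intro i _ hi
        rw [if_neg fun h' => hi (Subtype.ext h'.symm), mul_zero]
      · simp
    · refine Finset.sum_eq_zero fun i _ => ?_
      rw [if_neg fun h' : j = i => h (by rw [h']; exact i.2), mul_zero]
  set q : ℕ → H := fun n => p (fun i => inner ℂ (b i) (ψ (φ n))) with hq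
  have hqlim : Tendsto q atTop (nhds (p z)) := (hpc.tendsto z).comp hz
  set r : ℕ → H := fun n => ψ (φ n) - q n with hr
  have hrZ : ∀ n, ∀ i ∈ Z, inner ℂ (b i) (r n) = 0 := by
    intro n i hi
    rw [hr, inner_sub_right, hψZ _ i hi, hq]
    simp only
    rw [hpin, dif_neg fun h => hJZ i h hi, sub_zero]
  have hrJ : ∀ n, ∀ i ∈ J, inner ℂ (b i) (r n) = 0 := by
    intro n i hi
    rw [hr, inner_sub_right, hq]
    simp only
    rw [hpin, dif_pos hi, sub_self]
  have hOr : CauchySeq fun n => O (r n) := by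
    have : Tendsto (fun n => O (r n)) atTop (nhds (0 - O (p z))) := by
      simp only [hr, map_sub]
      exact (hO0.comp hφ.tendsto_atTop).sub ((O.continuous.tendsto _).comp hqlim)
    exact this.cauchySeq
  have hrC : CauchySeq r := by
    rw [Metric.cauchySeq_iff] at hOr ⊢
    intro ε hε
    obtain ⟨N, hN⟩ := hOr (Real.sqrt c * ε) (by positivity)
    refine ⟨N, fun m hm n hn => ?_⟩
    have h1 := hN m hm n hn
    rw [dist_eq_norm] at h1 ⊢
    have h2 := hlow (r m - r n)
      (fun i hi => by rw [inner_sub_right, hrZ m i hi, hrZ n i hi, sub_zero])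
      (fun i hi => by rw [inner_sub_right, hrJ m i hi, hrJ n i hi, sub_zero])
    rw [map_sub] at h2
    have h3 : (Real.sqrt c * ‖r m - r n‖) ^ 2 < (Real.sqrt c * ε) ^ 2 := by
      rw [mul_pow, Real.sq_sqrt hc.le]
      exact h2.trans_lt (pow_lt_pow_left₀ h1 (norm_nonneg _) two_ne_zero)
    exact lt_of_mul_lt_mul_left (lt_of_pow_lt_pow_left₀ 2 (by positivity) h3) (Real.sqrt_nonneg c)
  obtain ⟨r₀, hr₀⟩ := cauchySeq_tendsto_of_complete hrC
  have hψlim : Tendsto (fun n => ψ (φ n)) atTop (nhds (r₀ + p z)) := by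
    refine (hr₀.add hqlim).congr fun n => ?_
    simp [hr]
  have hzero : r₀ + p z = 0 := by
    refine hinj _ (fun i hi => ?_) ?_
    · refine tendsto_nhds_unique ((tendsto_const_nhds (x := b i)).inner hψlim) ?_
      simp only [hψZ _ i hi]
      exact tendsto_const_nhds
    · exact tendsto_nhds_unique ((O.continuous.tendsto _).comp hψlim)
        (hO0.comp hφ.tendsto_atTop)
  have h1 : ‖r₀ + p z‖ = 1 := by
    refine tendsto_nhds_unique hψlim.norm ?_
    simp only [hψ1]
    exact tendsto_const_nhds
  rw [hzero, norm_zero] at h1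
  exact zero_ne_one h1

end LowerBounds

section UniqueContinuation

variable {H : Type*} [NormedAddCommGroup H] [InnerProductSpace ℂ H]

theorem exists_small_separating_time {ι : Type*} [Countable ι] (ν : ι → ℝ) {δ : ℝ} (hδ : 0 < δ) :
    ∃ ε ∈ Set.Ioo 0 δ, ∀ i j,
      Complex.exp (Complex.I * ε * ν i) = Complex.exp (Complex.I * ε * ν j) → ν i = ν j := by
  have hcount : (Set.range fun p : ι × ι × ℤ =>
      2 * Real.pi * p.2.2 / (ν p.1 - ν p.2.1)).Countable := Set.countable_range _
  have hnot : ¬ (Set.Ioo 0 δ ⊆ Set.range fun p : ι × ι × ℤ =>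
      2 * Real.pi * p.2.2 / (ν p.1 - ν p.2.1)) := fun h =>
    (Cardinal.Real.Ioo_countable_iff.1 (hcount.mono h)).not_gt hδ
  obtain ⟨ε, hε, hbad⟩ := Set.not_subset.1 hnot
  refine ⟨ε, hε, fun i j hij => ?_⟩
  by_contra hne
  obtain ⟨n, hn⟩ := Complex.exp_eq_exp_iff_exists_int.1 hij
  apply hbad
  refine ⟨(i, j, n), ?_⟩
  have h1 : (Complex.I : ℂ) * (ε * ν i) = Complex.I * (ε * ν j + n * (2 * Real.pi)) := by
    rw [← mul_assoc, hn]; ring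
  have h2 : ε * ν i = ε * ν j + n * (2 * Real.pi) := by
    exact_mod_cast mul_left_cancel₀ Complex.I_ne_zero h1
  simp only
  rw [div_eq_iff (sub_ne_zero.2 hne)]
  linarith

/-- If high-frequency states are observable in time `T / 2`, then a state invisible during time `T`
has only frequencies occurring among the finitely many low modes. -/
theorem IsDiagonalGroup.frequencies_of_invisible {ι : Type*} [Countable ι]
    {b : HilbertBasis ι ℂ H} {ν : ι → ℝ}
    {U : ℝ → H →L[ℂ] H} (hU : IsDiagonalGroup b ν U) (G : H →L[ℂ] H) (Z : Set ι) (J : Finset ι)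
    {T : ℝ} (hT : 0 < T)
    (hhigh : ∀ ψ : H, (∀ i ∈ Z, inner ℂ (b i) ψ = 0) → (∀ i ∈ J, inner ℂ (b i) ψ = 0) →
      (∀ s ∈ Set.Ioo 0 (T / 2), G (U s ψ) = 0) → ψ = 0)
    {ψ : H} (hZ : ∀ i ∈ Z, inner ℂ (b i) ψ = 0) (hψ : ∀ s ∈ Set.Ioo 0 T, G (U s ψ) = 0)
    {i : ι} (hi : inner ℂ (b i) ψ ≠ 0) : ∃ j ∈ J, ν i = ν j := by
  classical
  obtain ⟨ε, ⟨hε0, hε⟩, hsep⟩ :=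
    exists_small_separating_time ν (δ := T / (2 * (J.card + 1))) (by positivity)
  have hstep : ∀ F : Finset ι, ∃ χ : H,
      (∀ i, inner ℂ (b i) χ = (∏ j ∈ F, (Complex.exp (Complex.I * ε * ν i) -
        Complex.exp (Complex.I * ε * ν j))) * inner ℂ (b i) ψ) ∧
      ∀ s ∈ Set.Ioo 0 (T - F.card * ε), G (U s χ) = 0 := by
    intro F
    induction F using Finset.induction_on with
    | empty => exact ⟨ψ, by simp, by simpa using hψ⟩
    | insert j F hj ih =>
      obtain ⟨χ, h1, h2⟩ := ih
      refine ⟨U ε χ - Complex.exp (Complex.I * ε * ν j) • χ, fun i => ?_, fun s hs => ?_⟩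
      · rw [inner_sub_right, inner_smul_right, hU, h1, Finset.prod_insert hj]
        ring
      · rw [Finset.card_insert_of_notMem hj] at hs
        push_cast at hs
        rw [map_sub, map_sub, ← hU.map_add, map_smul, map_smul,
          h2 s ⟨hs.1, by nlinarith [hs.2]⟩,
          h2 (s + ε) ⟨by linarith [hs.1], by nlinarith [hs.2]⟩]
        simp
  obtain ⟨χ, h1, h2⟩ := hstep J
  have hlen : T / 2 ≤ T - J.card * ε := by
    rw [lt_div_iff₀ (by positivity)] at hε
    nlinarith
  have hχ : χ = 0 := by
    refine hhigh χ (fun i hi => ?_) (fun i hi => ?_) fun s hs => h2 s ⟨hs.1, hs.2.trans_le hlen⟩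
    · rw [h1, hZ i hi, mul_zero]
    · rw [h1, Finset.prod_eq_zero hi (sub_self _), zero_mul]
  have h3 := h1 i
  rw [hχ, inner_zero_right] at h3
  obtain ⟨j, hj, h4⟩ := Finset.prod_eq_zero_iff.1 ((mul_eq_zero.1 h3.symm).resolve_right hi)
  exact ⟨j, hj, hsep i j (sub_eq_zero.1 h4)⟩

/-- If `G` maps different fibres `l` to orthogonal vectors and is injective on finite combinations
in each fibre, then it is injective on states with finitely many modes per fibre. -/
theorem HilbertBasis.eq_zero_of_fibrewise_finite [CompleteSpace H] {κ : Type*} [DecidableEq κ]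
    (b : HilbertBasis (ℤ × κ) ℂ H)
    (G : H →L[ℂ] H)
    (horth : ∀ k m l l', l ≠ l' → inner ℂ (G (b (k, l))) (G (b (m, l'))) = 0)
    (hind : ∀ (l : κ) (F : Finset ℤ) (a : ℤ → ℂ), 0 ∉ F →
      ∑ k ∈ F, a k • G (b (k, l)) = 0 → ∀ k ∈ F, a k = 0)
    {χ : H} (h0 : ∀ l, inner ℂ (b (0, l)) χ = 0)
    (hfin : ∀ l, {k : ℤ | inner ℂ (b (k, l)) χ ≠ 0}.Finite) (hG : G χ = 0) : χ = 0 := by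
  apply b.ext_inner
  rintro ⟨k, l⟩
  rw [inner_zero_right]
  by_contra hk
  set F := (hfin l).toFinset with hF
  set χl : H := ∑ m ∈ F, inner ℂ (b (m, l)) χ • b (m, l) with hχl
  have hcoord : ∀ m, inner ℂ (b (m, l)) χl = inner ℂ (b (m, l)) χ := by
    intro m
    simp only [hχl, inner_sum, inner_smul_right, orthonormal_iff_ite.1 b.orthonormal,
      Prod.mk.injEq, and_true, mul_ite, mul_one, mul_zero, Finset.sum_ite_eq]
    split_ifs with hm
    · rfl
    · simp only [hF, Set.Finite.mem_toFinset, Set.mem_ofPred_eq, not_not] at hm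
      exact hm.symm
  have hker : ∀ m l', l' ≠ l → inner ℂ (G (b (m, l'))) (G χl) = 0 := by
    intro m l' hl
    rw [hχl, map_sum, inner_sum]
    refine Finset.sum_eq_zero fun n _ => ?_
    rw [map_smul, inner_smul_right, horth _ _ _ _ hl, mul_zero]
  have hGl : G χl = 0 := by
    rw [← inner_self_eq_zero (𝕜 := ℂ)]
    have h1 : inner ℂ (G χl) (G χl) = inner ℂ (G χl) (G χ) := by
      rw [← ContinuousLinearMap.adjoint_inner_left, ← ContinuousLinearMap.adjoint_inner_left,
        ← b.tsum_inner_mul_inner, ← b.tsum_inner_mul_inner]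
      congr 1
      ext ⟨m, l'⟩
      by_cases hl : l' = l
      · rw [hl, hcoord]
      · rw [ContinuousLinearMap.adjoint_inner_left, ← inner_conj_symm, hker m l' hl]
        simp
    rw [h1, hG, inner_zero_right]
  rw [hχl, map_sum] at hGl
  simp only [map_smul] at hGl
  refine hk (hind l F _ ?_ hGl k ?_)
  · simp [hF, h0]
  · simpa [hF] using hk

end UniqueContinuation

section Frequencies

/-- The frequency `k³ - l²/k` of the mode `(k, l)` of the linearized KP-II equation. -/
def kpFreq (i : ℤ × ℤ) : ℝ := (i.1 : ℝ) ^ 3 - (i.2 : ℝ) ^ 2 / (i.1 : ℝ)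

theorem exists_kpFreq_gap (γ : ℝ) (N : ℕ) : ∃ M : ℕ, ∀ k m l : ℤ, k ≠ 0 → m ≠ 0 → k ≠ m →
    |k - m| ≤ N → ((M : ℤ) < |l| ∨ ((M : ℤ) < |k| ∧ (M : ℤ) < |m|)) →
    γ ≤ |kpFreq (k, l) - kpFreq (m, l)| := by
  obtain ⟨M, hM⟩ := exists_nat_ge (max (max γ N) (max 1 ((N : ℝ) ^ 2 * (γ + (N : ℝ) ^ 2))))
  refine ⟨M, fun k m l hk hm hkm hN hcase => ?_⟩
  have hMγ : γ ≤ M := (le_max_left _ _).trans ((le_max_left _ _).trans hM)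
  have hMN : (N : ℝ) ≤ M := (le_max_right _ _).trans ((le_max_left _ _).trans hM)
  have hM1 : (1 : ℝ) ≤ M := (le_max_left _ _).trans ((le_max_right _ _).trans hM)
  have hM2 : (N : ℝ) ^ 2 * (γ + (N : ℝ) ^ 2) ≤ M :=
    (le_max_right _ _).trans ((le_max_right _ _).trans hM)
  have hsub : (1 : ℝ) ≤ |(k : ℝ) - m| := by
    exact_mod_cast Int.one_le_abs (sub_ne_zero.2 hkm)
  have hNr : |(k : ℝ) - m| ≤ N := by exact_mod_cast hN
  have hcr : (M : ℝ) < |(l : ℝ)| ∨ ((M : ℝ) < |(k : ℝ)| ∧ (M : ℝ) < |(m : ℝ)|) := by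
    exact_mod_cast hcase
  have hx : (k : ℝ) ≠ 0 := by exact_mod_cast hk
  have hy : (m : ℝ) ≠ 0 := by exact_mod_cast hm
  simp only [kpFreq]
  generalize (k : ℝ) = x at *
  generalize (m : ℝ) = y at *
  generalize (l : ℝ) = z at *
  obtain ⟨q, hq⟩ : ∃ q, q = z ^ 2 / (x * y) := ⟨_, rfl⟩
  have hxy : x * y ≠ 0 := mul_ne_zero hx hy
  have hqm : q * (x * y) = z ^ 2 := by rw [hq, div_mul_cancel₀ _ hxy]
  have hfac : x ^ 3 - z ^ 2 / x - (y ^ 3 - z ^ 2 / y) =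
      (x - y) * (x ^ 2 + x * y + y ^ 2 + q) := by
    rw [hq]; field_simp; ring
  rw [hfac, abs_mul]
  suffices h : γ ≤ |x ^ 2 + x * y + y ^ 2 + q| from
    h.trans (le_mul_of_one_le_left (abs_nonneg _) hsub)
  rcases lt_or_gt_of_ne hxy with hneg | hpos
  · -- opposite signs
    have hsum : (x - y) ^ 2 ≤ (N : ℝ) ^ 2 := sq_le_sq' (by linarith [abs_le.1 hNr])
      (by linarith [abs_le.1 hNr])
    have hz : (M : ℝ) < |z| := by
      rcases hcr with h | ⟨h, -⟩
      · exact h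
      · exfalso
        have h1 : (M : ℝ) ^ 2 < x ^ 2 := by
          rw [← sq_abs x]; exact pow_lt_pow_left₀ h (by positivity) two_ne_zero
        have h2 : (N : ℝ) ^ 2 ≤ (M : ℝ) ^ 2 := pow_le_pow_left₀ (by positivity) hMN 2
        nlinarith [sq_nonneg y]
    have hz2 : (M : ℝ) ≤ z ^ 2 := by
      rw [← sq_abs z]; nlinarith
    have hN0 : 0 < (N : ℝ) ^ 2 := by nlinarith [sq_nonneg x, sq_nonneg y]
    have hxyN : -(x * y) ≤ (N : ℝ) ^ 2 := by nlinarith [sq_nonneg x, sq_nonneg y]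
    have hq0 : q ≤ 0 := by
      rw [hq]; exact div_nonpos_of_nonneg_of_nonpos (sq_nonneg _) hneg.le
    have hqN : γ + (N : ℝ) ^ 2 ≤ -q := by
      have : (N : ℝ) ^ 2 * (γ + (N : ℝ) ^ 2) ≤ (N : ℝ) ^ 2 * (-q) := by nlinarith
      exact le_of_mul_le_mul_left this hN0
    refine le_trans ?_ (neg_le_abs _)
    nlinarith
  · have hq0 : 0 ≤ q := by rw [hq]; positivity
    refine le_trans ?_ (le_abs_self _)
    rcases hcr with h | ⟨h, -⟩
    · have h1 : |z| ≤ x * y + q := by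
        apply abs_le_of_sq_le_sq _ (by positivity)
        nlinarith [sq_nonneg (x * y - q), sq_nonneg z]
      nlinarith [sq_nonneg x, sq_nonneg y]
    · have : (M : ℝ) < x ^ 2 := by rw [← sq_abs x]; nlinarith
      nlinarith [sq_nonneg y]

theorem finite_setOf_kpFreq_eq (l : ℤ) (μ : ℝ) : {k : ℤ | k ≠ 0 ∧ kpFreq (k, l) = μ}.Finite := by
  obtain ⟨M, hM⟩ := exists_nat_ge (|μ| + (l : ℝ) ^ 2 + 1)
  refine (Set.finite_Icc (-(M : ℤ)) M).subset ?_
  rintro k ⟨hk, hμ⟩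
  rw [Set.mem_Icc, ← abs_le]
  by_contra! hlt
  have h1 : (M : ℝ) < |(k : ℝ)| := by exact_mod_cast hlt
  have hk0 : (k : ℝ) ≠ 0 := by exact_mod_cast hk
  simp only [kpFreq] at hμ
  have h2 : (k : ℝ) ^ 4 = μ * k + (l : ℝ) ^ 2 := by
    field_simp at hμ
    linarith
  generalize (k : ℝ) = x at *
  have hx1 : 1 < |x| := by
    have := sq_nonneg (l : ℝ)
    have := abs_nonneg μ
    linarith
  have h3 : |x| ^ 4 ≤ |μ| * |x| + (l : ℝ) ^ 2 := by
    rw [← abs_pow, h2]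
    refine (abs_add_le _ _).trans ?_
    rw [abs_mul, abs_of_nonneg (sq_nonneg (l : ℝ))]
  have h4 : |x| ^ 2 ≤ |x| ^ 4 := pow_le_pow_right₀ hx1.le (by norm_num)
  nlinarith [sq_nonneg (l : ℝ), abs_nonneg μ]

end Frequencies

section Observability

variable {H : Type*} [NormedAddCommGroup H] [InnerProductSpace ℂ H]

theorem norm_integral_exp_le {T : ℝ} (hT : 0 ≤ T) (μ : ℝ) :
    ‖∫ s in Set.Ioo 0 T, Complex.exp (Complex.I * s * μ)‖ ≤ T := by
  have h := norm_setIntegral_le_of_norm_le_const (μ := volume) (s := Set.Ioo 0 T) (C := 1)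
    (f := fun s : ℝ => Complex.exp (Complex.I * s * μ)) (by simp) (fun s _ => by
      rw [show Complex.I * s * μ = ((s * μ : ℝ) : ℂ) * Complex.I by push_cast; ring,
        Complex.norm_exp_ofReal_mul_I])
  simpa [hT] using h

theorem norm_integral_exp_le_div {T : ℝ} (hT : 0 ≤ T) {γ μ : ℝ} (hγ : 0 < γ) (hμ : γ ≤ |μ|) :
    ‖∫ s in Set.Ioo 0 T, Complex.exp (Complex.I * s * μ)‖ ≤ 2 / γ := by
  have hμ0 : μ ≠ 0 := by
    rintro rfl
    rw [abs_zero] at hμ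
    linarith
  have hc : Complex.I * (μ : ℂ) ≠ 0 := mul_ne_zero Complex.I_ne_zero (by exact_mod_cast hμ0)
  have h1 : ∀ s : ℝ, ‖Complex.exp (Complex.I * μ * s)‖ = 1 := fun s => by
    rw [show Complex.I * μ * s = ((μ * s : ℝ) : ℂ) * Complex.I by push_cast; ring,
      Complex.norm_exp_ofReal_mul_I]
  rw [← integral_Ioc_eq_integral_Ioo, ← intervalIntegral.integral_of_le hT]
  simp only [mul_right_comm Complex.I _ (μ : ℂ)]
  rw [integral_exp_mul_complex hc, norm_div, norm_mul, Complex.norm_I, one_mul, Complex.norm_real,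
    Real.norm_eq_abs]
  refine div_le_div₀ zero_le_two ((norm_sub_le _ _).trans ?_) hγ hμ
  rw [h1, h1]
  norm_num

/-- The structural properties of the control operator used for observability: with
`v k = G (b (k, l))`, the Gram matrix is independent of the fibre `l`, is dominated by a summable
convolution kernel, has a uniformly positive diagonal, and the images are linearly independent. -/
structure FibreGram (b : HilbertBasis (ℤ × ℤ) ℂ H) (G : H →L[ℂ] H) where
  V : ℤ → ℤ → ℂ
  kernel : ℤ → ℝ
  d : ℝ
  inner_same : ∀ k m l, inner ℂ (G (b (k, l))) (G (b (m, l))) = V k m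
  inner_ne : ∀ k m l l', l ≠ l' → inner ℂ (G (b (k, l))) (G (b (m, l'))) = 0
  norm_le : ∀ k m, ‖V k m‖ ≤ kernel (k - m)
  summable : Summable kernel
  d_pos : 0 < d
  d_le : ∀ k l, k ≠ 0 → d ≤ ‖G (b (k, l))‖ ^ 2
  independent : ∀ (l : ℤ) (F : Finset ℤ) (a : ℤ → ℂ), 0 ∉ F →
      ∑ k ∈ F, a k • G (b (k, l)) = 0 → ∀ k ∈ F, a k = 0

variable {b : HilbertBasis (ℤ × ℤ) ℂ H} {U : ℝ → H →L[ℂ] H} {G : H →L[ℂ] H}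

theorem IsDiagonalGroup.inner_observation {ι : Type*} {b : HilbertBasis ι ℂ H} {ν : ι → ℝ}
    (hU : IsDiagonalGroup b ν U) {T : ℝ}
    {O : H →L[ℂ] Lp H 2 (volume.restrict (Set.Ioo (0 : ℝ) T))}
    (hO : ∀ ψ, O ψ =ᵐ[volume.restrict (Set.Ioo (0 : ℝ) T)] fun s => G (U s ψ)) (i j : ι) :
    inner ℂ (O (b i)) (O (b j)) = inner ℂ (G (b i)) (G (b j)) *
      ∫ s in Set.Ioo 0 T, Complex.exp (Complex.I * s * (ν j - ν i : ℝ)) := by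
  rw [L2.inner_def, ← integral_const_mul]
  refine integral_congr_ae ?_
  filter_upwards [hO (b i), hO (b j)] with s hi hj
  rw [hi, hj, hU.map_basis, hU.map_basis, map_smul, map_smul, inner_smul_left, inner_smul_right,
    ← Complex.exp_conj, ← mul_assoc, ← Complex.exp_add, mul_comm]
  congr 2
  simp only [_root_.map_mul, Complex.conj_I, Complex.conj_ofReal]
  push_cast
  ring

/-- Observability of the high-frequency part of the state. -/
theorem FibreGram.exists_high_frequency_bound (hG : FibreGram b G)
    (hU : IsDiagonalGroup b kpFreq U) {T : ℝ} (hT : 0 < T) :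
    ∃ J : Finset (ℤ × ℤ), ∀ O : H →L[ℂ] Lp H 2 (volume.restrict (Set.Ioo (0 : ℝ) T)),
      (∀ ψ, O ψ =ᵐ[volume.restrict (Set.Ioo (0 : ℝ) T)] fun s => G (U s ψ)) →
      ∀ ψ : H, (∀ l, inner ℂ (b (0, l)) ψ = 0) → (∀ i ∈ J, inner ℂ (b i) ψ = 0) →
        hG.d * T / 2 * ‖ψ‖ ^ 2 ≤ ‖O ψ‖ ^ 2 := by
  classical
  have hd := hG.d_pos
  have hq0 : ∀ n, 0 ≤ hG.kernel n := fun n => by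
    have := (norm_nonneg _).trans (hG.norm_le n 0)
    rwa [sub_zero] at this
  set Q := ∑' n, hG.kernel n with hQ
  have hQ0 : 0 ≤ Q := tsum_nonneg hq0
  obtain ⟨s, hs⟩ := summable_iff_vanishing_norm.1 hG.summable (hG.d / 4) (by positivity)
  set γ : ℝ := 8 * Q / (hG.d * T) + 1 with hγ
  have hγ0 : 0 < γ := by positivity
  have hγQ : 2 / γ * Q ≤ hG.d * T / 4 := by
    rw [div_mul_eq_mul_div, div_le_iff₀ hγ0, hγ, mul_add]
    have : hG.d * T / 4 * (8 * Q / (hG.d * T)) = 2 * Q := by field_simp; ring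
    rw [this]
    have : 0 < hG.d * T := by positivity
    linarith
  obtain ⟨M, hM⟩ := exists_kpFreq_gap γ (s.sup Int.natAbs)
  refine ⟨Finset.Icc (-(M : ℤ)) M ×ˢ Finset.Icc (-(M : ℤ)) M, fun O hO ψ h0 hJ => ?_⟩
  set J := Finset.Icc (-(M : ℤ)) M ×ˢ Finset.Icc (-(M : ℤ)) M with hJdef
  refine b.lower_bound_of_finset O ({i | i.1 = 0} ∪ (J : Set (ℤ × ℤ))) (fun F hF a => ?_) ?_
  swap
  · rintro ⟨k, l⟩ (hk | hi)
    · have hk' : k = 0 := hk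
      rw [hk', h0]
    · exact hJ _ hi
  have hF0 : ∀ i ∈ F, i.1 ≠ 0 := fun i hi h => hF i hi (Or.inl h)
  have hFJ : ∀ i ∈ F, (M : ℤ) < |i.2| ∨ (M : ℤ) < |i.1| := fun i hi => by
    by_contra! h
    refine hF i hi (Or.inr ?_)
    simp only [hJdef, Finset.coe_product, Set.mem_prod, Finset.coe_Icc, Set.mem_Icc, ← abs_le]
    exact ⟨h.2, h.1⟩
  refine norm_sum_sq_ge_of_diagonally_dominant (fun i => O (b i)) F (fun i hi => ?_)
    (fun i hi => ?_) a
  · have h1 := hU.inner_observation hO i i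
    rw [sub_self] at h1
    simp only [Complex.ofReal_zero, mul_zero, Complex.exp_zero] at h1
    have h2 := congrArg Complex.re h1
    rw [inner_self_eq_norm_sq_to_K, inner_self_eq_norm_sq_to_K] at h2
    have h3 : ‖O (b i)‖ ^ 2 = ‖G (b i)‖ ^ 2 * T := by
      have h4 : ((‖O (b i)‖ ^ 2 : ℝ) : ℂ).re = (((‖G (b i)‖ ^ 2 : ℝ) : ℂ) * (T : ℂ)).re := by
        push_cast
        refine h2.trans ?_
        simp [hT.le]
      rw [← Complex.ofReal_mul, Complex.ofReal_re, Complex.ofReal_re] at h4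
      exact h4
    rw [h3]
    exact mul_le_mul_of_nonneg_right (hG.d_le i.1 i.2 (hF0 i hi)) hT.le
  · set F' := (F.erase i).filter fun j => j.2 = i.2 with hF'
    have h1 : ∑ j ∈ F.erase i, ‖inner ℂ (O (b i)) (O (b j))‖ =
        ∑ j ∈ F', ‖inner ℂ (O (b i)) (O (b j))‖ := by
      rw [hF', Finset.sum_filter]
      refine Finset.sum_congr rfl fun j _ => ?_
      split_ifs with hj
      · rfl
      · rw [hU.inner_observation hO, hG.inner_ne _ _ _ _ (Ne.symm hj), zero_mul, norm_zero]
    have h2 : ∀ j ∈ F', ‖inner ℂ (O (b i)) (O (b j))‖ ≤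
        hG.kernel (i.1 - j.1) * (if i.1 - j.1 ∈ s then 2 / γ else T) := by
      intro j hj
      obtain ⟨k, l⟩ := i
      obtain ⟨m, l'⟩ := j
      simp only [hF', Finset.mem_filter, Finset.mem_erase] at hj
      obtain ⟨⟨hne, hjF⟩, rfl⟩ := hj
      rw [hU.inner_observation hO, hG.inner_same, norm_mul]
      refine mul_le_mul (hG.norm_le k m) ?_ (norm_nonneg _) (hq0 _)
      split_ifs with hks
      · refine norm_integral_exp_le_div hT.le hγ0 ?_
        refine hM m k l' (hF0 _ hjF) (hF0 _ hi) (fun h => hne (by rw [h])) ?_ ?_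
        · rw [abs_sub_comm, Int.abs_eq_natAbs]
          exact_mod_cast Finset.le_sup (f := Int.natAbs) hks
        · rcases hFJ _ hi with h | h
          · exact Or.inl h
          · rcases hFJ _ hjF with h' | h'
            · exact Or.inl h'
            · exact Or.inr ⟨h', h⟩
      · exact norm_integral_exp_le hT.le _
    rw [h1]
    refine (Finset.sum_le_sum h2).trans ?_
    have hinj : Set.InjOn (fun j : ℤ × ℤ => i.1 - j.1) F' := by
      intro x hx y hy hxy
      simp only [hF', Finset.coe_filter, Set.mem_ofPred_eq] at hx hy
      simp only [sub_right_inj] at hxy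
      exact Prod.ext hxy (hx.2.trans hy.2.symm)
    rw [← Finset.sum_image (f := fun n => hG.kernel n * (if n ∈ s then 2 / γ else T)) hinj]
    set t := F'.image fun j => i.1 - j.1
    rw [← Finset.sum_filter_add_sum_filter_not t (fun n => n ∈ s)]
    have h3 : ∑ n ∈ t.filter (fun n => n ∈ s), hG.kernel n * (if n ∈ s then 2 / γ else T) ≤
        hG.d * T / 4 := by
      rw [Finset.sum_congr rfl fun n hn => by rw [if_pos (Finset.mem_filter.1 hn).2],
        ← Finset.sum_mul, mul_comm]
      exact (mul_le_mul_of_nonneg_left (hG.summable.sum_le_tsum _ fun n _ => hq0 n)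
        (by positivity)).trans hγQ
    have h4 : ∑ n ∈ t.filter (fun n => n ∉ s), hG.kernel n * (if n ∈ s then 2 / γ else T) ≤
        hG.d * T / 4 := by
      rw [Finset.sum_congr rfl fun n hn => by rw [if_neg (Finset.mem_filter.1 hn).2],
        ← Finset.sum_mul]
      have := hs (t.filter (fun n => n ∉ s))
        (Finset.disjoint_left.2 fun n hn => (Finset.mem_filter.1 hn).2)
      have h5 := (le_abs_self _).trans this.le
      nlinarith
    linarith

/-- Observability of the linearized KP-II flow through `G`. -/
theorem FibreGram.exists_observability [CompleteSpace H] (hG : FibreGram b G)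
    (hU : IsDiagonalGroup b kpFreq U) {T : ℝ} (hT : 0 < T)
    (O : H →L[ℂ] Lp H 2 (volume.restrict (Set.Ioo (0 : ℝ) T)))
    (hO : ∀ ψ, O ψ =ᵐ[volume.restrict (Set.Ioo (0 : ℝ) T)] fun s => G (U s ψ)) :
    ∃ c : ℝ, 0 < c ∧ ∀ ψ : H, (∀ l, inner ℂ (b (0, l)) ψ = 0) → c * ‖ψ‖ ^ 2 ≤ ‖O ψ‖ ^ 2 := by
  classical
  have hd := hG.d_pos
  obtain ⟨J, hJ⟩ := hG.exists_high_frequency_bound hU hT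
  obtain ⟨J', hJ'⟩ := hG.exists_high_frequency_bound hU (half_pos hT)
  obtain ⟨O', hO'⟩ := hU.exists_observation G (T / 2)
  set Z : Set (ℤ × ℤ) := {i | i.1 = 0} with hZ
  have hZiff : ∀ ψ : H, (∀ i ∈ Z, inner ℂ (b i) ψ = 0) ↔ ∀ l, inner ℂ (b (0, l)) ψ = 0 := by
    refine fun ψ => ⟨fun h l => h (0, l) rfl, ?_⟩
    rintro h ⟨k, l⟩ hk
    have hk' : k = 0 := hk
    rw [hk', h]
  have hmain : ∀ ψ : H, (∀ i ∈ Z, inner ℂ (b i) ψ = 0) → O ψ = 0 → ψ = 0 := by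
    intro ψ h0 hψ
    have hinv : ∀ s ∈ Set.Ioo 0 T, G (U s ψ) = 0 := by
      have hcont : Continuous fun s => G (U s ψ) := G.continuous.comp (hU.continuous_orbit ψ)
      have hae : (fun s => G (U s ψ)) =ᵐ[volume.restrict (Set.Ioo (0 : ℝ) T)] fun _ => 0 := by
        refine (hO ψ).symm.trans ?_
        rw [hψ]
        exact Lp.coeFn_zero _ _ _
      exact Measure.eqOn_open_of_ae_eq hae isOpen_Ioo hcont.continuousOn continuousOn_const
    have hfreq : ∀ i, inner ℂ (b i) ψ ≠ 0 → ∃ j ∈ J', kpFreq i = kpFreq j := fun i hi => by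
      refine hU.frequencies_of_invisible G Z J' hT (fun χ hχ0 hχJ hχ => ?_) h0 hinv hi
      have h1 := hJ' O' hO' χ ((hZiff χ).1 hχ0) hχJ
      have h2 : O' χ = 0 := by
        rw [Lp.eq_zero_iff_ae_eq_zero]
        filter_upwards [hO' χ, ae_restrict_mem measurableSet_Ioo] with s hs hmem
        rw [hs, hχ s hmem]
        rfl
      rw [h2, norm_zero] at h1
      have h3 : ‖χ‖ ^ 2 ≤ 0 := by
        have : 0 < hG.d * (T / 2) / 2 := by positivity
        nlinarith
      exact norm_eq_zero.1 (pow_eq_zero_iff two_ne_zero |>.1 (le_antisymm h3 (sq_nonneg _)))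
    have hcoord : ∀ i, inner ℂ (b i) (U (T / 2) ψ) ≠ 0 → inner ℂ (b i) ψ ≠ 0 := by
      intro i hi h
      rw [hU, h, mul_zero] at hi
      exact hi rfl
    have hU0 : U (T / 2) ψ = 0 := by
      refine b.eq_zero_of_fibrewise_finite G hG.inner_ne hG.independent (fun l => ?_) (fun l => ?_)
        (hinv (T / 2) ⟨by positivity, by linarith⟩)
      · rw [hU, (hZiff ψ).1 h0, mul_zero]
      · refine (J'.finite_toSet.biUnion fun j _ => finite_setOf_kpFreq_eq l (kpFreq j)).subset ?_
        intro k hk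
        obtain ⟨j, hj, hkj⟩ := hfreq _ (hcoord _ hk)
        refine Set.mem_biUnion hj ⟨?_, hkj⟩
        rintro rfl
        exact hcoord _ hk ((hZiff ψ).1 h0 l)
    rw [← norm_eq_zero, ← hU.norm_map (T / 2), hU0, norm_zero]
  obtain ⟨c, hc, h⟩ := b.bounded_below_of_injective O Z (J.filter fun i => i ∉ Z)
    (fun i hi => (Finset.mem_filter.1 hi).2) (c := hG.d * T / 2) (by positivity)
    (fun ψ h0 h1 => hJ O hO ψ ((hZiff ψ).1 h0) fun i hi => by
      by_cases hiZ : i ∈ Z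
      · exact h0 i hiZ
      · exact h1 i (Finset.mem_filter.2 ⟨hi, hiZ⟩)) hmain
  exact ⟨c, hc, fun ψ h0 => h ψ ((hZiff ψ).2 h0)⟩

end Observability

section ZeroModeFree

variable {H : Type*} [NormedAddCommGroup H] [InnerProductSpace ℂ H]

/-- The states whose coordinates `(0, l)` all vanish. -/
def zeroModeFree (b : HilbertBasis (ℤ × ℤ) ℂ H) : Submodule ℂ H :=
  (Submodule.span ℂ (Set.range fun l : ℤ => b (0, l)))ᗮ

theorem mem_zeroModeFree (b : HilbertBasis (ℤ × ℤ) ℂ H) {φ : H} :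
    φ ∈ zeroModeFree b ↔ ∀ l, inner ℂ (b (0, l)) φ = 0 := by
  rw [zeroModeFree, Submodule.mem_orthogonal]
  refine ⟨fun h l => h _ (Submodule.subset_span ⟨l, rfl⟩), fun h u hu => ?_⟩
  induction hu using Submodule.span_induction with
  | mem x hx => obtain ⟨l, rfl⟩ := hx; exact h l
  | zero => exact inner_zero_left _
  | add x y _ _ hx hy => rw [inner_add_left, hx, hy, add_zero]
  | smul a x _ hx => rw [inner_smul_left, hx, mul_zero]

instance [CompleteSpace H] (b : HilbertBasis (ℤ × ℤ) ℂ H) : CompleteSpace (zeroModeFree b) :=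
  inferInstanceAs (CompleteSpace ((Submodule.span ℂ (Set.range fun l : ℤ => b (0, l)))ᗮ :
    Submodule ℂ H))

end ZeroModeFree

section Control

variable {H : Type*} [NormedAddCommGroup H] [InnerProductSpace ℂ H] [CompleteSpace H]
  {b : HilbertBasis (ℤ × ℤ) ℂ H} {U : ℝ → H →L[ℂ] H} {G : H →L[ℂ] H}

/-- The Hilbert uniqueness method: observability yields a bounded right inverse of the
input-to-state map. -/
theorem FibreGram.exists_control (hG : FibreGram b G) (hU : IsDiagonalGroup b kpFreq U)
    (hsymm : ∀ u v, inner ℂ (G u) v = inner ℂ u (G v)) (hG0 : ∀ l, G (b (0, l)) = 0)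
    {T : ℝ} (hT : 0 < T) :
    ∃ R : H →L[ℂ] Lp H 2 (volume.restrict (Set.Ioo (0 : ℝ) T)),
      ∀ z : H, (∀ l, inner ℂ (b (0, l)) z = 0) →
        ∫ s in Set.Ioo 0 T, U (T - s) (G ((R z : ℝ → H) s)) = z := by
  obtain ⟨O, hO⟩ := hU.exists_observation G T
  obtain ⟨c, hc, hobs⟩ := hG.exists_observability hU hT O hO
  set B := O ∘L U (-T) with hB
  have hBae : ∀ φ, B φ =ᵐ[volume.restrict (Set.Ioo (0 : ℝ) T)] fun s => G (U (s - T) φ) := by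
    intro φ
    filter_upwards [hO (U (-T) φ)] with s hs
    rw [hB, ContinuousLinearMap.comp_apply, hs, ← hU.map_add, sub_eq_add_neg]
  have hBlow : ∀ φ, (∀ l, inner ℂ (b (0, l)) φ = 0) → c * ‖φ‖ ^ 2 ≤ ‖B φ‖ ^ 2 := by
    intro φ hφ
    have := hobs (U (-T) φ) fun l => by rw [hU, hφ, mul_zero]
    rwa [hU.norm_map] at this
  have hB0 : ∀ l, B (b (0, l)) = 0 := by
    intro l
    rw [Lp.eq_zero_iff_ae_eq_zero]
    filter_upwards [hBae (b (0, l))] with s hs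
    rw [hs, hU.map_basis, map_smul, hG0, smul_zero]
    rfl
  have hadj0 : ∀ h l, inner ℂ (b (0, l)) (B.adjoint h) = 0 := fun h l => by
    rw [ContinuousLinearMap.adjoint_inner_right, hB0, inner_zero_left]
  set K := zeroModeFree b with hK
  have hKmem : ∀ φ, φ ∈ K ↔ ∀ l, inner ℂ (b (0, l)) φ = 0 := fun φ => mem_zeroModeFree b
  set P := K.starProjection with hP
  set L : H →L[ℂ] H := B.adjoint ∘L B + (ContinuousLinearMap.id ℂ H - P) with hL
  have hBP : ∀ φ, B φ = B (P φ) := by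
    intro φ
    rw [← sub_eq_zero, ← map_sub, ← inner_self_eq_zero (𝕜 := ℂ),
      ← ContinuousLinearMap.adjoint_inner_right]
    exact Submodule.starProjection_inner_eq_zero _ _ ((hKmem _).2 (hadj0 _))
  have hcoer : ∀ φ, ‖φ‖ ^ 2 * ((min c 1).toNNReal : ℝ) ≤ ‖inner ℂ (L φ) φ‖ := by
    intro φ
    have h1 : inner ℂ (L φ) φ = ((‖B φ‖ ^ 2 + ‖φ - P φ‖ ^ 2 : ℝ) : ℂ) := by
      have h2 : inner ℂ (φ - P φ) φ = ((‖φ - P φ‖ ^ 2 : ℝ) : ℂ) := by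
        have h3 : inner ℂ (φ - P φ) (P φ) = 0 :=
          Submodule.starProjection_inner_eq_zero _ _ (Submodule.starProjection_apply_mem _ _)
        have h4 : inner ℂ (φ - P φ) (φ - P φ) = ((‖φ - P φ‖ ^ 2 : ℝ) : ℂ) := by
          rw [inner_self_eq_norm_sq_to_K]; push_cast; rfl
        rw [← h4, inner_sub_right _ φ, h3, sub_zero]
      have h5 : inner ℂ (B φ) (B φ) = ((‖B φ‖ ^ 2 : ℝ) : ℂ) := by
        rw [inner_self_eq_norm_sq_to_K]; push_cast; rfl
      rw [hL, add_apply, inner_add_left, ContinuousLinearMap.comp_apply,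
        ContinuousLinearMap.adjoint_inner_left, sub_apply,
        ContinuousLinearMap.id_apply, h2, h5, Complex.ofReal_add]
    have hpyth : ‖φ‖ ^ 2 = ‖P φ‖ ^ 2 + ‖φ - P φ‖ ^ 2 := by
      have h3 : inner ℂ (P φ) (φ - P φ) = 0 := by
        rw [← inner_conj_symm, Submodule.starProjection_inner_eq_zero _ _
          (Submodule.starProjection_apply_mem _ _), _root_.map_zero]
      have := norm_add_sq_eq_norm_sq_add_norm_sq_of_inner_eq_zero _ _ h3
      rw [add_sub_cancel] at this
      nlinarith
    have h6 := hBlow (P φ) ((hKmem _).1 (Submodule.starProjection_apply_mem _ _))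
    rw [← hBP] at h6
    rw [h1, Complex.norm_real, Real.norm_of_nonneg (by positivity),
      Real.coe_toNNReal _ (by positivity), hpyth]
    nlinarith [min_le_left c 1, min_le_right c 1, sq_nonneg ‖P φ‖, sq_nonneg ‖φ - P φ‖]
  obtain ⟨Linv, hLinv⟩ :=
    (ContinuousLinearMap.isUnit_of_forall_le_norm_inner_map L
      (Real.toNNReal_pos.2 (by positivity)) hcoer).exists_right_inv
  refine ⟨B ∘L Linv, fun z hz => ?_⟩
  set φ := Linv z with hφ
  have hLφ : L φ = z := by
    have := congrArg (fun A : H →L[ℂ] H => A z) hLinv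
    exact this
  have hBB : B.adjoint (B φ) = z := by
    have h1 : B.adjoint (B φ) + (φ - P φ) = z := hLφ
    have h2 : φ - P φ ∈ K := by
      rw [← sub_eq_iff_eq_add'.2 h1.symm]
      exact K.sub_mem ((hKmem z).2 hz) ((hKmem _).2 (hadj0 _))
    have h3 : φ - P φ = 0 := by
      rw [← inner_self_eq_zero (𝕜 := ℂ)]
      exact Submodule.starProjection_inner_eq_zero _ _ h2
    rw [h3, add_zero] at h1
    exact h1
  have hcont : Continuous fun s => U (T - s) (G (G (U (s - T) φ))) :=
    hU.continuous_comp (continuous_const.sub continuous_id)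
      (G.continuous.comp (G.continuous.comp ((hU.continuous_orbit φ).comp
        (continuous_id.sub continuous_const))))
  have hae : (fun s => U (T - s) (G ((B φ : ℝ → H) s))) =ᵐ[volume.restrict (Set.Ioo (0 : ℝ) T)]
      fun s => U (T - s) (G (G (U (s - T) φ))) := by
    filter_upwards [hBae φ] with s hs
    rw [hs]
  have hint : Integrable (fun s => U (T - s) (G ((B φ : ℝ → H) s)))
      (volume.restrict (Set.Ioo (0 : ℝ) T)) :=
    ((hcont.integrableOn_Icc (a := 0) (b := T)).mono_set Set.Ioo_subset_Icc_self).congr hae.symm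
  change ∫ s in Set.Ioo 0 T, U (T - s) (G ((B φ : ℝ → H) s)) = z
  refine ext_inner_left ℂ fun χ => ?_
  rw [← integral_inner hint, ← hBB, ContinuousLinearMap.adjoint_inner_right, L2.inner_def]
  refine integral_congr_ae ?_
  filter_upwards [hBae χ] with s hs
  rw [hs, hsymm, hU.inner_map_left, neg_sub]

end Control

section TorusBasis

open ComplexConjugate

theorem integral_fourier_torus (n : ℤ) :
    ∫ x : Torus, fourier n x = if n = 0 then ((2 * Real.pi : ℝ) : ℂ) else 0 := by
  split_ifs with h
  · subst h
    simp [measureReal_def, AddCircle.measure_univ, Real.pi_pos.le]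
  · exact integral_eq_zero_of_add_right_eq_neg (fourier_add_half_inv_index h (Fact.out))

theorem integral_torus_mul (f g : Torus → ℂ) :
    ∫ p : Torus2, f p.1 * g p.2 = (∫ x, f x) * ∫ y, g y := by
  rw [Measure.volume_eq_prod, integral_prod_mul]

/-- The normalised exponential `(2π)⁻¹ e^{i(kx+ly)}`. -/
def torusMode (i : ℤ × ℤ) : C(Torus2, ℂ) :=
  ((1 / (2 * Real.pi) : ℝ) : ℂ) •
    (((fourier i.1).comp ContinuousMap.fst) * ((fourier i.2).comp ContinuousMap.snd))

theorem torusMode_apply (i : ℤ × ℤ) (p : Torus2) :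
    torusMode i p = ((1 / (2 * Real.pi) : ℝ) : ℂ) * (fourier i.1 p.1 * fourier i.2 p.2) := rfl

/-- The normalised exponentials as elements of `L²(𝕋²)`. -/
def torusVec (i : ℤ × ℤ) : L2T2 := ContinuousMap.toLp 2 volume ℂ (torusMode i)

theorem torusVec_ae (i : ℤ × ℤ) : torusVec i =ᵐ[volume] torusMode i :=
  ContinuousMap.coeFn_toLp _ _

theorem orthonormal_torusVec : Orthonormal ℂ torusVec := by
  rw [orthonormal_iff_ite]
  rintro ⟨k, l⟩ ⟨m, n⟩
  rw [torusVec, torusVec, ContinuousMap.inner_toLp]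
  have h : ∀ p : Torus2, torusMode (m, n) p * conj (torusMode (k, l) p) =
      ((1 / (2 * Real.pi) : ℝ) : ℂ) ^ 2 *
        (fourier (m - k) p.1 * fourier (n - l) p.2) := by
    intro p
    rw [torusMode_apply, torusMode_apply, map_mul, map_mul, Complex.conj_ofReal, ← fourier_neg,
      ← fourier_neg, sub_eq_add_neg, sub_eq_add_neg, fourier_add, fourier_add]
    ring
  simp only [h]
  rw [integral_const_mul, integral_torus_mul, integral_fourier_torus, integral_fourier_torus]
  have hpi : (Real.pi : ℂ) ≠ 0 := by exact_mod_cast Real.pi_ne_zero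
  by_cases h1 : k = m <;> by_cases h2 : l = n
  · subst h1 h2
    simp
    field_simp
  all_goals simp [h1, h2, sub_eq_zero, eq_comm (a := m), eq_comm (a := n)]

/-- The star subalgebra of trigonometric polynomials on `𝕋²`. -/
def torusSubalgebra : StarSubalgebra ℂ C(Torus2, ℂ) where
  toSubalgebra := Algebra.adjoin ℂ (Set.range torusMode)
  star_mem' := by
    change Algebra.adjoin ℂ (Set.range torusMode) ≤
      star (Algebra.adjoin ℂ (Set.range torusMode))
    refine Algebra.adjoin_le ?_
    rintro - ⟨i, rfl⟩
    refine Algebra.subset_adjoin ⟨-i, ?_⟩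
    ext p
    change torusMode (-i) p = conj (torusMode i p)
    rw [torusMode_apply, torusMode_apply, map_mul, map_mul, Complex.conj_ofReal, ← fourier_neg,
      ← fourier_neg]
    rfl

theorem torusSubalgebra_coe : Subalgebra.toSubmodule torusSubalgebra.toSubalgebra =
    Submodule.span ℂ (Set.range torusMode) := by
  have hpi : (Real.pi : ℂ) ≠ 0 := by exact_mod_cast Real.pi_ne_zero
  apply Algebra.adjoin_eq_span_of_subset
  intro x hx
  suffices h : ∃ (c : ℂ) (i : ℤ × ℤ), x = c • torusMode i by
    obtain ⟨c, i, rfl⟩ := h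
    exact Submodule.smul_mem _ _ (Submodule.subset_span ⟨i, rfl⟩)
  induction hx using Submonoid.closure_induction with
  | mem x hx => obtain ⟨i, rfl⟩ := hx; exact ⟨1, i, (one_smul _ _).symm⟩
  | one =>
    refine ⟨2 * Real.pi, 0, ?_⟩
    ext p
    rw [ContinuousMap.smul_apply, torusMode_apply]
    simp
    field_simp
  | mul x y _ _ hx hy =>
    obtain ⟨c, i, rfl⟩ := hx
    obtain ⟨c', j, rfl⟩ := hy
    refine ⟨c * c' * ((1 / (2 * Real.pi) : ℝ) : ℂ), i + j, ?_⟩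
    ext p
    simp only [ContinuousMap.smul_apply, ContinuousMap.mul_apply, torusMode_apply, smul_eq_mul,
      Prod.fst_add, Prod.snd_add, fourier_add]
    ring

theorem torusSubalgebra_separatesPoints : torusSubalgebra.SeparatesPoints := by
  have hpi : ((1 / (2 * Real.pi) : ℝ) : ℂ) ≠ 0 := by
    exact_mod_cast (by positivity : (1 / (2 * Real.pi) : ℝ) ≠ 0)
  rintro ⟨x, y⟩ ⟨x', y'⟩ hne
  by_cases h : x = x'
  · refine ⟨_, ⟨torusMode (0, 1), Algebra.subset_adjoin ⟨(0, 1), rfl⟩, rfl⟩, ?_⟩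
    dsimp only
    rw [torusMode_apply, torusMode_apply]
    dsimp only
    intro heq
    have := mul_left_cancel₀ hpi heq
    rw [fourier_zero, fourier_zero, one_mul, one_mul, fourier_one, fourier_one] at this
    exact hne (by rw [h, AddCircle.injective_toCircle two_pi_pos.ne' (Subtype.coe_injective this)])
  · refine ⟨_, ⟨torusMode (1, 0), Algebra.subset_adjoin ⟨(1, 0), rfl⟩, rfl⟩, ?_⟩
    dsimp only
    rw [torusMode_apply, torusMode_apply]
    dsimp only
    intro heq
    have := mul_left_cancel₀ hpi heq
    rw [fourier_zero, fourier_zero, mul_one, mul_one, fourier_one, fourier_one] at this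
    exact h (AddCircle.injective_toCircle two_pi_pos.ne' (Subtype.coe_injective this))

theorem span_torusMode_closure_eq_top :
    (Submodule.span ℂ (Set.range torusMode)).topologicalClosure = ⊤ := by
  rw [← torusSubalgebra_coe]
  exact congr_arg (Subalgebra.toSubmodule <| StarSubalgebra.toSubalgebra ·)
    (ContinuousMap.starSubalgebra_topologicalClosure_eq_top_of_separatesPoints torusSubalgebra
      torusSubalgebra_separatesPoints)

theorem span_torusVec_closure_eq_top :
    (Submodule.span ℂ (Set.range torusVec)).topologicalClosure = ⊤ := by
  have := (ContinuousMap.toLp_denseRange ℂ (volume : Measure Torus2) ℂ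
    (p := 2) (by norm_num)).topologicalClosure_map_submodule span_torusMode_closure_eq_top
  rw [Submodule.map_span, ← Set.range_comp] at this
  exact this

/-- The Fourier Hilbert basis of `L²(𝕋²)`. -/
def torusBasis : HilbertBasis (ℤ × ℤ) ℂ L2T2 :=
  HilbertBasis.mk orthonormal_torusVec span_torusVec_closure_eq_top.ge

theorem torusBasis_apply (i : ℤ × ℤ) : torusBasis i = torusVec i := by
  rw [torusBasis, HilbertBasis.coe_mk]

theorem inner_torusBasis (k l : ℤ) (u : L2T2) :
    inner ℂ (torusBasis (k, l)) u = (2 * Real.pi : ℝ) * fc2 u k l := by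
  have hpi : (Real.pi : ℂ) ≠ 0 := by exact_mod_cast Real.pi_ne_zero
  rw [torusBasis_apply, L2.inner_def, fc2]
  have h : ∫ p : Torus2, inner ℂ (torusVec (k, l) p) (u p) =
      ∫ p : Torus2, ((1 / (2 * Real.pi) : ℝ) : ℂ) *
        (fourier (-k) p.1 * fourier (-l) p.2 * u p) := by
    refine integral_congr_ae ?_
    filter_upwards [torusVec_ae (k, l)] with p hp
    rw [hp, torusMode_apply, RCLike.inner_apply, map_mul, map_mul, Complex.conj_ofReal,
      fourier_neg, fourier_neg]
    ring
  rw [h, integral_const_mul]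
  push_cast
  field_simp
  ring

theorem meanZero2_iff (u : L2T2) :
    MeanZero2 u ↔ ∀ l, inner ℂ (torusBasis (0, l)) u = 0 := by
  have hpi : ((2 * Real.pi : ℝ) : ℂ) ≠ 0 := by exact_mod_cast two_pi_pos.ne'
  refine forall_congr' fun l => ?_
  rw [inner_torusBasis, mul_eq_zero, or_iff_right hpi]

end TorusBasis

section FourierDecay

theorem integral_torus_eq (f : Torus → ℂ) :
    ∫ x : Torus, f x = ∫ x in (-Real.pi)..Real.pi, f (x : Torus) := by
  rw [← AddCircle.intervalIntegral_preimage (2 * Real.pi) (-Real.pi) f]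
  congr 1
  ring

theorem fourier_torus_coe (n : ℤ) (x : ℝ) :
    (fourier n (x : Torus) : ℂ) = Complex.exp (Complex.I * n * x) := by
  have hpi : (Real.pi : ℂ) ≠ 0 := by exact_mod_cast Real.pi_ne_zero
  rw [fourier_coe_apply]
  congr 1
  push_cast
  field_simp

theorem integral_deriv_mul_exp {F F' : ℝ → ℝ} (hF : ∀ x, HasDerivAt F (F' x) x)
    (hF' : Continuous F') (hper : F Real.pi = F (-Real.pi)) (n : ℤ) :
    ∫ x in (-Real.pi)..Real.pi, (F' x : ℂ) * Complex.exp (Complex.I * n * x) =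
      -(Complex.I * n) *
        ∫ x in (-Real.pi)..Real.pi, (F x : ℂ) * Complex.exp (Complex.I * n * x) := by
  have hFc : Continuous F := continuous_iff_continuousAt.2 fun x => (hF x).continuousAt
  have hd : ∀ x : ℝ, HasDerivAt (fun x : ℝ => (F x : ℂ) * Complex.exp (Complex.I * n * x))
      ((F' x : ℂ) * Complex.exp (Complex.I * n * x) +
        Complex.I * n * ((F x : ℂ) * Complex.exp (Complex.I * n * x))) x := by
    intro x
    have h1 : HasDerivAt (fun x : ℝ => Complex.exp (Complex.I * n * x))
        (Complex.exp (Complex.I * n * x) * (Complex.I * n * 1)) x :=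
      (((hasDerivAt_id (x : ℂ)).const_mul (Complex.I * n)).cexp).comp_ofReal
    exact ((hF x).ofReal_comp.mul h1).congr_deriv (by ring)
  have hper' : Complex.exp (Complex.I * n * (Real.pi : ℝ)) =
      Complex.exp (Complex.I * n * (-Real.pi : ℝ)) := by
    rw [Complex.exp_eq_exp_iff_exists_int]
    exact ⟨n, by push_cast; ring⟩
  have key := intervalIntegral.integral_eq_sub_of_hasDerivAt (a := -Real.pi) (b := Real.pi)
    (fun x _ => hd x) (Continuous.intervalIntegrable (by fun_prop) _ _)
  rw [intervalIntegral.integral_add (Continuous.intervalIntegrable (by fun_prop) _ _)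
    (Continuous.intervalIntegrable (by fun_prop) _ _), intervalIntegral.integral_const_mul,
    hper, hper', sub_self] at key
  linear_combination key

theorem norm_integral_mul_exp_le (F : ℝ → ℝ) (n : ℤ) :
    ‖∫ x in (-Real.pi)..Real.pi, (F x : ℂ) * Complex.exp (Complex.I * n * x)‖ ≤
      ∫ x in (-Real.pi)..Real.pi, |F x| := by
  refine (intervalIntegral.norm_integral_le_integral_norm (by linarith [Real.pi_pos])).trans_eq ?_
  congr 1
  ext x
  rw [norm_mul, Complex.norm_real, Real.norm_eq_abs,
    show Complex.I * n * x = ((n * x : ℝ) : ℂ) * Complex.I by push_cast; ring,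
    Complex.norm_exp_ofReal_mul_I, mul_one]

theorem exists_fourier_decay {f : Torus → ℝ} (hf : ContDiff ℝ 2 fun x : ℝ => f x) :
    ∃ C : ℝ, 0 ≤ C ∧ ∀ n : ℤ,
      ‖∫ x : Torus, (f x : ℂ) * fourier n x‖ ≤ C * (1 / (1 + (n : ℝ) ^ 2)) := by
  set F : ℝ → ℝ := fun x : ℝ => f x with hFdef
  have hper : Function.Periodic F (2 * Real.pi) := fun x => by
    simp only [hFdef, AddCircle.coe_add_period]
  have hF1 : ContDiff ℝ 1 (deriv F) := by
    have : ContDiff ℝ (1 + 1) F := by simpa [one_add_one_eq_two] using hf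
    exact (contDiff_succ_iff_deriv.1 this).2.2
  have hd0 : ∀ x, HasDerivAt F (deriv F x) x := fun x =>
    (hf.differentiable (by norm_num) x).hasDerivAt
  have hd1 : ∀ x, HasDerivAt (deriv F) (deriv (deriv F) x) x := fun x =>
    (hF1.differentiable (by norm_num) x).hasDerivAt
  have hF2 : Continuous (deriv (deriv F)) := hF1.continuous_deriv le_rfl
  have hend : ∀ {E : ℝ → ℝ}, Function.Periodic E (2 * Real.pi) → E Real.pi = E (-Real.pi) :=
    fun {E} hE => by
      rw [← hE (-Real.pi)]
      congr 1
      ring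
  have hper1 : Function.Periodic (deriv F) (2 * Real.pi) := fun x => by
    rw [← deriv_comp_add_const, funext hper]
  refine ⟨(∫ x in (-Real.pi)..Real.pi, |F x|) + ∫ x in (-Real.pi)..Real.pi, |deriv (deriv F) x|,
    add_nonneg ?_ ?_, fun n => ?_⟩
  iterate 2
    exact intervalIntegral.integral_nonneg (by linarith [Real.pi_pos]) fun _ _ => abs_nonneg _
  have h0 : 0 < 1 + (n : ℝ) ^ 2 := by positivity
  rw [mul_one_div, le_div_iff₀ h0, integral_torus_eq]
  simp only [fourier_torus_coe]
  change ‖∫ x in (-Real.pi)..Real.pi, (F x : ℂ) * Complex.exp (Complex.I * n * x)‖ * _ ≤ _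
  have h1 := norm_integral_mul_exp_le F n
  have h2 := norm_integral_mul_exp_le (deriv (deriv F)) n
  rw [integral_deriv_mul_exp hd1 hF2 (hend hper1), integral_deriv_mul_exp hd0 hF1.continuous
    (hend hper)] at h2
  simp only [norm_mul, norm_neg, Complex.norm_I, one_mul, Complex.norm_intCast] at h2
  have h3 : |(n : ℝ)| * |(n : ℝ)| = (n : ℝ) ^ 2 := by rw [← abs_mul, ← sq, abs_sq]
  rw [← mul_assoc, h3] at h2
  linarith

theorem decay_mul_le (x y : ℝ) :
    1 / (1 + x ^ 2) * (1 / (1 + y ^ 2)) ≤ 2 * (1 / (1 + (x - y) ^ 2)) := by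
  rw [div_mul_div_comm, one_mul, mul_one_div, div_le_div_iff₀ (by positivity) (by positivity)]
  nlinarith [sq_nonneg (x + y), sq_nonneg (x * y), sq_nonneg x, sq_nonneg y]

theorem summable_decay : Summable fun n : ℤ => 1 / (1 + (n : ℝ) ^ 2) := by
  have h : Summable fun n : ℤ => 1 / (n : ℝ) ^ 2 :=
    Real.summable_one_div_int_pow.2 one_lt_two
  refine Summable.of_norm_bounded_eventually h ?_
  filter_upwards [(Set.finite_singleton (0 : ℤ)).compl_mem_cofinite] with n hn
  have hn0 : (0 : ℝ) < (n : ℝ) ^ 2 := by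
    have : (n : ℝ) ≠ 0 := by exact_mod_cast hn
    positivity
  rw [Real.norm_of_nonneg (by positivity)]
  exact one_div_le_one_div_of_le hn0 (by linarith)

end FourierDecay

section VerticalControl

open ComplexConjugate

theorem inner_of_ae_mul_fourier {u v : L2T2} {f₁ f₂ : Torus → ℂ} {l l' : ℤ}
    (hu : ∀ᵐ p, u p = f₁ p.1 * fourier l p.2) (hv : ∀ᵐ p, v p = f₂ p.1 * fourier l' p.2) :
    inner ℂ u v = if l = l' then (2 * Real.pi : ℝ) * ∫ x, conj (f₁ x) * f₂ x else 0 := by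
  have h : ∫ p : Torus2, inner ℂ (u p) (v p) =
      ∫ p : Torus2, conj (f₁ p.1) * f₂ p.1 * fourier (l' - l) p.2 := by
    refine integral_congr_ae ?_
    filter_upwards [hu, hv] with p hp hq
    rw [hp, hq, RCLike.inner_apply, map_mul, ← fourier_neg, sub_eq_add_neg, fourier_add]
    ring
  rw [L2.inner_def, h, integral_torus_mul (fun x => conj (f₁ x) * f₂ x), integral_fourier_torus]
  simp only [sub_eq_zero, eq_comm (a := l')]
  split_ifs
  · rw [mul_comm]
  · rw [mul_zero]

/-- The Fourier integrals of a function on `𝕋`. -/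
def fourierInt (f : Torus → ℝ) (n : ℤ) : ℂ := ∫ x : Torus, (f x : ℂ) * fourier n x

theorem fourierInt_neg (f : Torus → ℝ) (n : ℤ) : fourierInt f (-n) = conj (fourierInt f n) := by
  rw [fourierInt, fourierInt, ← integral_conj]
  simp only [map_mul, Complex.conj_ofReal, fourier_neg]

theorem fourierInt_zero (f : Torus → ℝ) : fourierInt f 0 = ((∫ x, f x : ℝ) : ℂ) := by
  simp only [fourierInt, fourier_zero, mul_one]
  exact integral_ofReal

/-- The one-dimensional profile `γ (e_k - ∫ γ e_k)` of the image of an exponential. -/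
def perpProfile (γ : Torus → ℝ) (k : ℤ) (x : Torus) : ℂ :=
  γ x * (fourier k x - fourierInt γ k)

theorem ae_slice {P : Torus2 → Prop} (h : ∀ᵐ p, P p) : ∀ᵐ p : Torus2, ∀ᵐ x : Torus, P (x, p.2) := by
  rw [Measure.volume_eq_prod] at h ⊢
  have h1 : ∀ᵐ q ∂((volume : Measure Torus).prod (volume : Measure Torus)), P q.swap :=
    Measure.measurePreserving_swap.quasiMeasurePreserving.ae h
  exact Measure.quasiMeasurePreserving_snd.ae (Measure.ae_ae_of_ae_prod h1)

theorem torusBasis_ae (k l : ℤ) : ∀ᵐ p, torusBasis (k, l) p =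
    ((1 / (2 * Real.pi) : ℝ) : ℂ) * fourier k p.1 * fourier l p.2 := by
  rw [torusBasis_apply]
  filter_upwards [torusVec_ae (k, l)] with p hp
  rw [hp, torusMode_apply, mul_assoc]

variable {γ : Torus → ℝ} {G : L2T2 →L[ℂ] L2T2}

theorem IsGperp.torusBasis_ae (hG : IsGperp γ G) (k l : ℤ) : ∀ᵐ p, G (torusBasis (k, l)) p =
    ((1 / (2 * Real.pi) : ℝ) : ℂ) * perpProfile γ k p.1 * fourier l p.2 := by
  filter_upwards [hG (torusBasis (k, l)), _root_.torusBasis_ae k l,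
    ae_slice (_root_.torusBasis_ae k l)] with p h1 h2 h3
  have h4 : ∫ x : Torus, (γ x : ℂ) * torusBasis (k, l) (x, p.2) =
      ∫ x : Torus, ((1 / (2 * Real.pi) : ℝ) : ℂ) * fourier l p.2 * ((γ x : ℂ) * fourier k x) := by
    refine integral_congr_ae ?_
    filter_upwards [h3] with x hx
    rw [hx]
    ring
  rw [h1, h2, h4, integral_const_mul, perpProfile, fourierInt]
  ring

theorem IsGperp.inner_basis (hG : IsGperp γ G) (hγ : Continuous γ) (k m l l' : ℤ) :
    inner ℂ (torusBasis (k, l)) (G (torusBasis (m, l'))) =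
      if l = l' then ((1 / (2 * Real.pi) : ℝ) : ℂ) *
        (fourierInt γ (m - k) - fourierInt γ m * fourierInt γ (-k)) else 0 := by
  rw [inner_of_ae_mul_fourier (f₁ := fun x => ((1 / (2 * Real.pi) : ℝ) : ℂ) * fourier k x)
    (f₂ := fun x => ((1 / (2 * Real.pi) : ℝ) : ℂ) * perpProfile γ m x)
    (_root_.torusBasis_ae k l) (hG.torusBasis_ae m l')]
  congr 1
  have hpi : (Real.pi : ℂ) ≠ 0 := by exact_mod_cast Real.pi_ne_zero
  have h : ∀ x : Torus, conj (((1 / (2 * Real.pi) : ℝ) : ℂ) * fourier k x) *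
      (((1 / (2 * Real.pi) : ℝ) : ℂ) * perpProfile γ m x) =
      ((1 / (2 * Real.pi) : ℝ) : ℂ) ^ 2 * (γ x * fourier (m - k) x -
        fourierInt γ m * (γ x * fourier (-k) x)) := by
    intro x
    rw [map_mul, Complex.conj_ofReal, ← fourier_neg, perpProfile, sub_eq_add_neg m, fourier_add]
    ring
  have hi : ∀ n : ℤ, Integrable fun x : Torus => (γ x : ℂ) * fourier n x := fun n =>
    Continuous.integrable_of_hasCompactSupport (by fun_prop) (HasCompactSupport.of_compactSpace _)
  simp only [h]
  rw [integral_const_mul, integral_sub (hi _) ((hi _).const_mul _), integral_const_mul,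
    ← fourierInt, ← fourierInt]
  push_cast
  field_simp

theorem IsGperp.inner_comm (hG : IsGperp γ G) (hγ : Continuous γ) (u v : L2T2) :
    inner ℂ (G u) v = inner ℂ u (G v) := by
  have h : G.adjoint = G := by
    refine torusBasis.clm_ext fun j => torusBasis.ext_inner fun i => ?_
    obtain ⟨k, l⟩ := i
    obtain ⟨m, l'⟩ := j
    rw [ContinuousLinearMap.adjoint_inner_right, ← inner_conj_symm, hG.inner_basis hγ,
      hG.inner_basis hγ, apply_ite conj, map_zero]
    simp only [map_mul, map_sub, ← fourierInt_neg, Complex.conj_ofReal, neg_sub, neg_neg,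
      eq_comm (a := l')]
    rw [mul_comm (fourierInt γ (-k))]
  rw [← ContinuousLinearMap.adjoint_inner_right, h]

theorem IsGperp.basis_zero (hG : IsGperp γ G) (hint : ∫ x, γ x = 1) (l : ℤ) :
    G (torusBasis (0, l)) = 0 := by
  rw [Lp.eq_zero_iff_ae_eq_zero]
  filter_upwards [hG.torusBasis_ae 0 l] with p hp
  rw [hp, perpProfile, fourierInt_zero, hint, fourier_zero]
  simp

theorem IsGperp.inner_same (hG : IsGperp γ G) (hγ : Continuous γ) (k m l l' : ℤ) :
    inner ℂ (G (torusBasis (k, l))) (G (torusBasis (m, l'))) =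
      if l = l' then ((1 / (2 * Real.pi) : ℝ) : ℂ) *
        (fourierInt (fun x => γ x ^ 2) (m - k)
          - fourierInt γ m * fourierInt (fun x => γ x ^ 2) (-k)
          - fourierInt γ (-k) * fourierInt (fun x => γ x ^ 2) m
          + fourierInt γ (-k) * fourierInt γ m * fourierInt (fun x => γ x ^ 2) 0) else 0 := by
  rw [inner_of_ae_mul_fourier (f₁ := fun x => ((1 / (2 * Real.pi) : ℝ) : ℂ) * perpProfile γ k x)
    (f₂ := fun x => ((1 / (2 * Real.pi) : ℝ) : ℂ) * perpProfile γ m x)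
    (hG.torusBasis_ae k l) (hG.torusBasis_ae m l')]
  congr 1
  have hpi : (Real.pi : ℂ) ≠ 0 := by exact_mod_cast Real.pi_ne_zero
  have h : ∀ x : Torus, conj (((1 / (2 * Real.pi) : ℝ) : ℂ) * perpProfile γ k x) *
      (((1 / (2 * Real.pi) : ℝ) : ℂ) * perpProfile γ m x) =
      ((1 / (2 * Real.pi) : ℝ) : ℂ) ^ 2 * (((γ x ^ 2 : ℝ) : ℂ) * fourier (m - k) x
        - fourierInt γ m * (((γ x ^ 2 : ℝ) : ℂ) * fourier (-k) x)
        - fourierInt γ (-k) * (((γ x ^ 2 : ℝ) : ℂ) * fourier m x)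
        + fourierInt γ (-k) * fourierInt γ m * (((γ x ^ 2 : ℝ) : ℂ) * fourier 0 x)) := by
    intro x
    rw [map_mul, Complex.conj_ofReal, perpProfile, perpProfile, map_mul, map_sub, ← fourier_neg,
      ← fourierInt_neg, Complex.conj_ofReal, sub_eq_add_neg m, fourier_add, fourier_zero]
    push_cast
    ring
  have hi : ∀ f : Torus → ℂ, Continuous f → Integrable f := fun f hf =>
    hf.integrable_of_hasCompactSupport (HasCompactSupport.of_compactSpace _)
  simp only [h]
  rw [integral_const_mul, integral_add, integral_sub, integral_sub, integral_const_mul,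
    integral_const_mul, integral_const_mul]
  · simp only [fourierInt]
    push_cast
    field_simp
  all_goals exact hi _ (by fun_prop)

/-- The continuous representative of the image of an exponential. -/
def perpMode (hγ : Continuous γ) (k l : ℤ) : C(Torus2, ℂ) where
  toFun p := ((1 / (2 * Real.pi) : ℝ) : ℂ) * perpProfile γ k p.1 * fourier l p.2
  continuous_toFun := by
    unfold perpProfile
    fun_prop

theorem IsGperp.torusBasis_eq (hG : IsGperp γ G) (hγ : Continuous γ) (k l : ℤ) :
    G (torusBasis (k, l)) = ContinuousMap.toLp 2 volume ℂ (perpMode hγ k l) := by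
  refine Lp.ext ?_
  filter_upwards [hG.torusBasis_ae k l, ContinuousMap.coeFn_toLp (p := 2) (𝕜 := ℂ)
    (volume : Measure Torus2) (perpMode hγ k l)] with p h1 h2
  rw [h1, h2]
  rfl

theorem exists_ne_zero_of_integral_eq_one (hint : ∫ x, γ x = 1) : ∃ x : ℝ, γ x ≠ 0 := by
  by_contra! h
  have h0 : γ = 0 := by
    ext x
    obtain ⟨x, rfl⟩ := QuotientAddGroup.mk_surjective x
    exact h x
  simp [h0] at hint

/-- A trigonometric polynomial which is constant where `γ ≠ 0` is constant. -/
theorem sum_fourier_eq_const (hγ : Continuous γ) (hint : ∫ x, γ x = 1) (F : Finset ℤ) (a : ℤ → ℂ)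
    (c : ℂ) (h : ∀ x, γ x ≠ 0 → ∑ k ∈ F, a k * fourier k x = c) (x : Torus) :
    ∑ k ∈ F, a k * fourier k x = c := by
  obtain ⟨x₀, hx₀⟩ := exists_ne_zero_of_integral_eq_one hint
  set P : ℂ → ℂ := fun z => ∑ k ∈ F, a k * Complex.exp (Complex.I * k * z) with hP
  have hPd : Differentiable ℂ P := by fun_prop
  have hPx : ∀ x : ℝ, P x = ∑ k ∈ F, a k * fourier k (x : Torus) := fun x => by
    simp only [hP, fourier_torus_coe]
  have hev : ∀ᶠ x : ℝ in nhds x₀, P x = c := by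
    have hc : Continuous fun x : ℝ => γ x := hγ.comp (AddCircle.continuous_mk' _)
    filter_upwards [hc.continuousAt.eventually_ne hx₀] with x hx
    rw [hPx, h _ hx]
  have ht : Tendsto (fun x : ℝ => (x : ℂ)) (nhdsWithin x₀ {x₀}ᶜ)
      (nhdsWithin (x₀ : ℂ) {(x₀ : ℂ)}ᶜ) :=
    tendsto_nhdsWithin_iff.2 ⟨(Complex.continuous_ofReal.tendsto x₀).mono_left nhdsWithin_le_nhds,
      eventually_mem_nhdsWithin.mono fun x hx => by simpa using hx⟩
  have hfr : ∃ᶠ z in nhdsWithin (x₀ : ℂ) {(x₀ : ℂ)}ᶜ, P z = c :=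
    ht.frequently (hev.filter_mono nhdsWithin_le_nhds).frequently
  have hall : P = fun _ => c :=
    AnalyticOnNhd.eq_of_frequently_eq (fun z _ => hPd.analyticAt z)
      (fun z _ => analyticAt_const) hfr
  obtain ⟨x, rfl⟩ := QuotientAddGroup.mk_surjective x
  exact (hPx x).symm.trans (congrFun hall x)

theorem eq_zero_of_sum_fourier_eq_const {F : Finset ℤ} {a : ℤ → ℂ} {c : ℂ} (hF : 0 ∉ F)
    (h : ∀ x : Torus, ∑ k ∈ F, a k * fourier k x = c) : ∀ m ∈ F, a m = 0 := by
  intro m hm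
  have hm0 : m ≠ 0 := fun h0 => hF (h0 ▸ hm)
  have hpi : ((2 * Real.pi : ℝ) : ℂ) ≠ 0 := by exact_mod_cast two_pi_pos.ne'
  have h1 : ∫ x : Torus, (∑ k ∈ F, a k * fourier k x) * fourier (-m) x = 0 := by
    simp only [h]
    rw [integral_const_mul, integral_fourier_torus, if_neg (neg_ne_zero.2 hm0), mul_zero]
  simp only [Finset.sum_mul, mul_assoc, ← fourier_add, ← sub_eq_add_neg] at h1
  rw [integral_finsetSum _ fun k _ => Continuous.integrable_of_hasCompactSupport (by fun_prop)
    (HasCompactSupport.of_compactSpace _)] at h1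
  simp only [integral_const_mul, integral_fourier_torus, sub_eq_zero, mul_ite, mul_zero,
    Finset.sum_ite_eq', if_pos hm, mul_eq_zero, hpi, or_false] at h1
  exact h1

theorem IsGperp.independent (hG : IsGperp γ G) (hγ : Continuous γ) (hint : ∫ x, γ x = 1)
    (l : ℤ) (F : Finset ℤ) (a : ℤ → ℂ) (hF : 0 ∉ F)
    (h : ∑ k ∈ F, a k • G (torusBasis (k, l)) = 0) : ∀ k ∈ F, a k = 0 := by
  have hκ : ((1 / (2 * Real.pi) : ℝ) : ℂ) ≠ 0 := by
    exact_mod_cast (by positivity : (1 / (2 * Real.pi) : ℝ) ≠ 0)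
  simp only [hG.torusBasis_eq hγ, ← map_smul, ← map_sum] at h
  have h0 : ∑ k ∈ F, a k • perpMode hγ k l = 0 :=
    ContinuousMap.toLp_injective (p := 2) (𝕜 := ℂ) (volume : Measure Torus2)
      (h.trans (map_zero _).symm)
  refine eq_zero_of_sum_fourier_eq_const hF
    (sum_fourier_eq_const hγ hint F a (∑ k ∈ F, a k * fourierInt γ k) fun x hx => ?_)
  have hx' : (γ x : ℂ) ≠ 0 := by exact_mod_cast hx
  have h1 := congrArg (fun f : C(Torus2, ℂ) => f (x, 0)) h0
  simp only [ContinuousMap.coe_sum, Finset.sum_apply, ContinuousMap.smul_apply,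
    ContinuousMap.zero_apply] at h1
  refine sub_eq_zero.1 (mul_left_cancel₀ (mul_ne_zero hκ hx') ?_)
  rw [mul_zero, ← Finset.sum_sub_distrib, Finset.mul_sum, ← h1]
  refine Finset.sum_congr rfl fun k _ => ?_
  change _ = a k • (((1 / (2 * Real.pi) : ℝ) : ℂ) * perpProfile γ k x * fourier l (0 : Torus))
  rw [fourier_eval_zero, perpProfile, smul_eq_mul]
  ring

theorem exists_pos_le_of_tendsto {N : ℤ → ℝ} {d : ℝ} (hd : 0 < d)
    (hN : Tendsto N cofinite (nhds d)) (hpos : ∀ k, k ≠ 0 → 0 < N k) :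
    ∃ ε : ℝ, 0 < ε ∧ ∀ k, k ≠ 0 → ε ≤ N k := by
  have hfin : {k : ℤ | ¬ d / 2 ≤ N k}.Finite :=
    eventually_cofinite.1 (hN.eventually_const_le (half_lt_self hd))
  by_cases hne : ({k : ℤ | ¬ d / 2 ≤ N k} \ {0}).Nonempty
  · obtain ⟨m, hm, hmin⟩ := Set.exists_min_image _ N hfin.sdiff hne
    refine ⟨min (d / 2) (N m), lt_min (half_pos hd) (hpos m hm.2), fun k hk => ?_⟩
    by_cases hk' : d / 2 ≤ N k
    · exact (min_le_left _ _).trans hk'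
    · exact (min_le_right _ _).trans (hmin k ⟨hk', hk⟩)
  · refine ⟨d / 2, half_pos hd, fun k hk => ?_⟩
    by_contra hlt
    exact hne ⟨k, hlt, hk⟩

/-- The Gram matrix of the images of the exponentials in one fibre. -/
def perpGram (γ : Torus → ℝ) (k m : ℤ) : ℂ :=
  ((1 / (2 * Real.pi) : ℝ) : ℂ) *
    (fourierInt (fun x => γ x ^ 2) (m - k)
      - fourierInt γ m * fourierInt (fun x => γ x ^ 2) (-k)
      - fourierInt γ (-k) * fourierInt (fun x => γ x ^ 2) m
      + fourierInt γ (-k) * fourierInt γ m * fourierInt (fun x => γ x ^ 2) 0)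

theorem norm_perpGram_le {A B : ℝ} (hA0 : 0 ≤ A) (hB0 : 0 ≤ B)
    (hA : ∀ n : ℤ, ‖fourierInt γ n‖ ≤ A * (1 / (1 + (n : ℝ) ^ 2)))
    (hB : ∀ n : ℤ, ‖fourierInt (fun x => γ x ^ 2) n‖ ≤ B * (1 / (1 + (n : ℝ) ^ 2))) (k m : ℤ) :
    ‖perpGram γ k m‖ ≤ 1 / (2 * Real.pi) * (B + 4 * (A * B) + 2 * (A * A * B)) *
      (1 / (1 + ((k - m : ℤ) : ℝ) ^ 2)) := by
  have hq : ∀ n : ℤ, 0 ≤ 1 / (1 + (n : ℝ) ^ 2) := fun n => by positivity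
  have hA' : ∀ n : ℤ, ‖fourierInt γ (-n)‖ ≤ A * (1 / (1 + (n : ℝ) ^ 2)) := fun n => by
    simpa using hA (-n)
  have hB' : ∀ n : ℤ, ‖fourierInt (fun x => γ x ^ 2) (-n)‖ ≤ B * (1 / (1 + (n : ℝ) ^ 2)) :=
    fun n => by simpa using hB (-n)
  have hmul := decay_mul_le k m
  have h1 : ‖fourierInt (fun x => γ x ^ 2) (m - k)‖ ≤ B * (1 / (1 + ((k - m : ℤ) : ℝ) ^ 2)) := by
    simpa using hB' (k - m)
  have h4 : ‖fourierInt (fun x => γ x ^ 2) 0‖ ≤ B := by simpa using hB 0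
  have h5 := mul_le_mul (mul_le_mul (hA' k) (hA m) (norm_nonneg (fourierInt γ m))
    (mul_nonneg hA0 (hq k))) h4 (norm_nonneg _)
    (mul_nonneg (mul_nonneg hA0 (hq k)) (mul_nonneg hA0 (hq m)))
  have h2 := mul_le_mul (hA m) (hB' k) (norm_nonneg _) (mul_nonneg hA0 (hq m))
  have h3 := mul_le_mul (hA' k) (hB m) (norm_nonneg _) (mul_nonneg hA0 (hq k))
  rw [← norm_mul] at h2 h3
  rw [← norm_mul, ← norm_mul] at h5
  rw [perpGram, norm_mul, Complex.norm_real, Real.norm_of_nonneg (by positivity),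
    mul_assoc (1 / (2 * Real.pi))]
  refine mul_le_mul_of_nonneg_left ?_ (by positivity)
  refine (norm_add_le _ _).trans ?_
  refine (add_le_add_left ((norm_sub_le _ _).trans
    (add_le_add_left (norm_sub_le _ _) _)) _).trans ?_
  push_cast at h1 ⊢
  have hAB := mul_le_mul_of_nonneg_left hmul (mul_nonneg hA0 hB0)
  have hAAB := mul_le_mul_of_nonneg_left hmul (mul_nonneg (mul_nonneg hA0 hA0) hB0)
  linarith

theorem tendsto_fourierInt {f : Torus → ℝ} {A : ℝ}
    (hA : ∀ n : ℤ, ‖fourierInt f n‖ ≤ A * (1 / (1 + (n : ℝ) ^ 2))) :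
    Tendsto (fourierInt f) cofinite (nhds 0) := by
  refine squeeze_zero_norm hA ?_
  simpa using summable_decay.tendsto_cofinite_zero.const_mul A

theorem integral_sq_pos (hγ : Continuous γ) (hint : ∫ x, γ x = 1) : 0 < ∫ x, γ x ^ 2 := by
  obtain ⟨x₀, hx₀⟩ := exists_ne_zero_of_integral_eq_one hint
  exact (hγ.pow 2).integral_pos_of_hasCompactSupport_nonneg_nonzero
    (HasCompactSupport.of_compactSpace _) (fun x => sq_nonneg _) (pow_ne_zero 2 hx₀)

theorem IsGperp.norm_sq_basis (hG : IsGperp γ G) (hγ : Continuous γ) (k l : ℤ) :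
    ‖G (torusBasis (k, l))‖ ^ 2 = (perpGram γ k k).re := by
  rw [← inner_self_eq_norm_sq (𝕜 := ℂ), hG.inner_same hγ, if_pos rfl]
  rfl

theorem continuous_of_comp_coe (hγ : Continuous fun x : ℝ => γ x) : Continuous γ :=
  isQuotientMap_quotient_mk'.continuous_iff.2 hγ

theorem IsGperp.nonempty_fibreGram (hG : IsGperp γ G) (hγ : ContDiff ℝ 2 fun x : ℝ => γ x)
    (hint : ∫ x, γ x = 1) : Nonempty (FibreGram torusBasis G) := by
  have hγc : Continuous γ := continuous_of_comp_coe hγ.continuous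
  obtain ⟨A, hA0, hA⟩ := exists_fourier_decay hγ
  obtain ⟨B, hB0, hB⟩ := exists_fourier_decay (f := fun x => γ x ^ 2) (hγ.pow 2)
  have hA' := tendsto_fourierInt hA
  have hB' := tendsto_fourierInt hB
  have hneg : Tendsto (fun k : ℤ => -k) cofinite cofinite := neg_injective.tendsto_cofinite
  have hpos : 0 < 1 / (2 * Real.pi) * ∫ x, γ x ^ 2 :=
    mul_pos (by positivity) (integral_sq_pos hγc hint)
  have hlim : Tendsto (fun k => (perpGram γ k k).re) cofinite
      (nhds (1 / (2 * Real.pi) * ∫ x, γ x ^ 2)) := by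
    have h := ((((hA'.mul (hB'.comp hneg)).const_sub (fourierInt (fun x => γ x ^ 2) 0)).sub
      ((hA'.comp hneg).mul hB')).add (((hA'.comp hneg).mul hA').mul_const
        (fourierInt (fun x => γ x ^ 2) 0))).const_mul ((1 / (2 * Real.pi) : ℝ) : ℂ)
    have h' := (Complex.continuous_re.tendsto _).comp h
    simp only [mul_zero, sub_zero, zero_mul, add_zero, fourierInt_zero, ← Complex.ofReal_mul,
      Complex.ofReal_re] at h'
    refine h'.congr fun k => ?_
    simp only [Function.comp_apply, perpGram, sub_self, fourierInt_zero]
  have hpos' : ∀ k, k ≠ 0 → 0 < (perpGram γ k k).re := by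
    intro k hk
    rw [← hG.norm_sq_basis hγc k 0]
    refine pow_pos (norm_pos_iff.2 fun h0 => ?_) 2
    refine one_ne_zero (hG.independent hγc hint 0 {k} (fun _ => (1 : ℂ)) ?_ ?_ k
      (Finset.mem_singleton_self k))
    · rw [Finset.mem_singleton]
      exact hk.symm
    · rw [Finset.sum_singleton, h0, smul_zero]
  obtain ⟨d, hd0, hd⟩ := exists_pos_le_of_tendsto hpos hlim hpos'
  exact ⟨{
    V := perpGram γ
    kernel := fun n => 1 / (2 * Real.pi) * (B + 4 * (A * B) + 2 * (A * A * B)) *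
      (1 / (1 + (n : ℝ) ^ 2))
    d := d
    inner_same := fun k m l => by rw [hG.inner_same hγc, if_pos rfl, perpGram]
    inner_ne := fun k m l l' hl => by rw [hG.inner_same hγc, if_neg hl]
    norm_le := norm_perpGram_le hA0 hB0 hA hB
    summable := summable_decay.mul_left _
    d_pos := hd0
    d_le := fun k l hk => by
      rw [hG.norm_sq_basis hγc]
      exact hd k hk
    independent := hG.independent hγc hint }⟩

theorem IsGperp.meanZero2 (hG : IsGperp γ G) (hγ : Continuous γ) (hint : ∫ x, γ x = 1)
    (h : L2T2) : MeanZero2 (G h) := by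
  rw [meanZero2_iff]
  intro l
  rw [← hG.inner_comm hγ, hG.basis_zero hint, inner_zero_left]

end VerticalControl

section KPGroup

variable {S : ℝ → L2T2 →L[ℂ] L2T2}

/-- The extension of a KP group on `L²₀(𝕋²)` by the identity on the orthogonal complement. -/
def kpExtension (S : ℝ → L2T2 →L[ℂ] L2T2) (t : ℝ) : L2T2 →L[ℂ] L2T2 :=
  S t ∘L (zeroModeFree torusBasis).starProjection +
    (ContinuousLinearMap.id ℂ L2T2 - (zeroModeFree torusBasis).starProjection)

theorem mem_zeroModeFree_torusBasis {u : L2T2} : u ∈ zeroModeFree torusBasis ↔ MeanZero2 u := by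
  rw [mem_zeroModeFree, meanZero2_iff]

theorem kpExtension_apply_of_meanZero2 {u : L2T2} (hu : MeanZero2 u) (t : ℝ) :
    kpExtension S t u = S t u := by
  have h : (zeroModeFree torusBasis).starProjection u = u :=
    Submodule.starProjection_eq_self_iff.2 (mem_zeroModeFree_torusBasis.2 hu)
  simp [kpExtension, h]

theorem kpPhase_eq (t : ℝ) (k l : ℤ) :
    kpPhase t k l = Complex.exp (Complex.I * t * (kpFreq (k, l) : ℝ)) := by
  rw [kpPhase, kpFreq]
  push_cast
  rfl

theorem IsKPGroup.isDiagonalGroup (hS : IsKPGroup S) :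
    IsDiagonalGroup torusBasis kpFreq (kpExtension S) := by
  rintro t u ⟨k, l⟩
  set K := zeroModeFree torusBasis
  have hP : MeanZero2 (K.starProjection u) :=
    mem_zeroModeFree_torusBasis.1 (Submodule.starProjection_apply_mem K u)
  have hU : kpExtension S t u = S t (K.starProjection u) + (u - K.starProjection u) := rfl
  by_cases hk : k = 0
  · subst hk
    rw [hU, inner_add_right, inner_sub_right, (meanZero2_iff _).1 (hS t _ hP).1,
      (meanZero2_iff _).1 hP]
    simp [kpFreq]
  · have hmem : torusBasis (k, l) ∈ K := by
      refine (mem_zeroModeFree _).2 fun m => ?_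
      rw [torusBasis.orthonormal.2]
      simpa [Prod.ext_iff] using fun h : 0 = k => absurd h.symm hk
    have h0 : inner ℂ (torusBasis (k, l)) (u - K.starProjection u) = 0 := by
      rw [← inner_conj_symm, Submodule.starProjection_inner_eq_zero _ _ hmem, map_zero]
    have h1 : inner ℂ (torusBasis (k, l)) u = inner ℂ (torusBasis (k, l)) (K.starProjection u) := by
      rw [← sub_eq_zero, ← inner_sub_right, h0]
    rw [hU, inner_add_right, h0, add_zero, h1, inner_torusBasis, inner_torusBasis,
      (hS t _ hP).2 k l hk, kpPhase_eq]
    ring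

end KPGroup

/-- Proposition 3.11, the HUM control operator: there is a bounded linear
operator `Υ : L²₀(𝕋²) × L²₀(𝕋²) → L²((0,T); L²(𝕋²))` such that the control `h = Υ(u₀,u₁)`
drives the solution of the linearized KP-II control system from `u₀` to `u₁`, with the bound
`‖Υ(u₀,u₁)‖ ≤ C(‖u₀‖ + ‖u₁‖)`. -/
theorem exists_control_operator_vertical
    -- `g` is a fixed real-valued C² function on `𝕋` (2π-periodic on `ℝ`), nonnegative,
    -- with integral 1, vanishing outside `(a,b) ⊂ (-π,π)`:
    (g : ℝ → ℝ) (hg_reg : ContDiff ℝ 2 g) (hg_per : Function.Periodic g (2 * Real.pi))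
    (hg_nonneg : ∀ x, 0 ≤ g x)
    (a b : ℝ) (ha : -Real.pi < a) (hab : a < b) (hb : b < Real.pi)
    (hg_supp : ∀ x ∈ Set.Ioc (-Real.pi) Real.pi, g x ≠ 0 → x ∈ Set.Ioo a b)
    (hg_int : ∫ x in (-Real.pi)..Real.pi, g x = 1)
    (S : ℝ → L2T2 →L[ℂ] L2T2) (hS : IsKPGroup S)
    (G : L2T2 →L[ℂ] L2T2) (hG : IsGperp hg_per.lift G)
    (T : ℝ) (hT : 0 < T) :
    ∃ Υ : (L2T2 × L2T2) →L[ℂ] (Lp L2T2 2 (volume.restrict (Set.Ioo (0:ℝ) T))),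
      ∃ C : ℝ, 0 < C ∧
        ∀ u₀ u₁ : L2T2, MeanZero2 u₀ → MeanZero2 u₁ →
          S T u₀ + (∫ s in (0:ℝ)..T, S (T - s) (G ((Υ (u₀, u₁) : ℝ → L2T2) s))) = u₁ ∧
          ‖Υ (u₀, u₁)‖ ≤ C * (‖u₀‖ + ‖u₁‖) := by
  have hγ : ContDiff ℝ 2 fun x : ℝ => hg_per.lift (x : Torus) := hg_reg
  have hγc : Continuous hg_per.lift := continuous_of_comp_coe hγ.continuous
  have hint : ∫ x : Torus, hg_per.lift x = 1 := by
    rw [← hg_int, ← AddCircle.intervalIntegral_preimage (2 * Real.pi) (-Real.pi)]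
    congr 1
    ring
  obtain ⟨hF⟩ := hG.nonempty_fibreGram hγ hint
  obtain ⟨R, hR⟩ := hF.exists_control hS.isDiagonalGroup (hG.inner_comm hγc)
    (hG.basis_zero hint) hT
  set D : L2T2 × L2T2 →L[ℂ] L2T2 := ContinuousLinearMap.snd ℂ L2T2 L2T2 -
    kpExtension S T ∘L ContinuousLinearMap.fst ℂ L2T2 L2T2 with hD
  refine ⟨R ∘L D, ‖R ∘L D‖ + 1, by positivity, fun u₀ u₁ h₀ h₁ => ⟨?_, ?_⟩⟩
  · have hDz : D (u₀, u₁) = u₁ - S T u₀ := by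
      rw [← kpExtension_apply_of_meanZero2 h₀ T]
      rfl
    have hz : ∀ l, inner ℂ (torusBasis (0, l)) (D (u₀, u₁)) = 0 := fun l => by
      rw [hDz, inner_sub_right, (meanZero2_iff _).1 h₁, (meanZero2_iff _).1 (hS T _ h₀).1, sub_zero]
    rw [intervalIntegral.integral_of_le hT.le, integral_Ioc_eq_integral_Ioo,
      ← eq_sub_iff_add_eq', ← hDz, ← hR _ hz]
    simp only [kpExtension_apply_of_meanZero2 (hG.meanZero2 hγc hint _)]
    rfl
  · refine ((R ∘L D).le_opNorm _).trans ?_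
    have hle : ‖(u₀, u₁)‖ ≤ ‖u₀‖ + ‖u₁‖ :=
      max_le (le_add_of_nonneg_right (norm_nonneg _)) (le_add_of_nonneg_left (norm_nonneg _))
    exact mul_le_mul (le_add_of_nonneg_right zero_le_one) hle (norm_nonneg _) (by positivity)
end
end

section
/- Let 0 < α < π, let ω = (−π,−α) ∪ (α,π) ⊂ 𝕋, and let T > 0. There exist a sequence (h_n) in (0,1) with h_n → 0 and a sequence (u_{n,0}) in L²(𝕋) such that, letting u_n denote the solution of the semiclassical Schrödinger equation i h_n ∂ₜu_n + h_n² ∂ₓ²u_n = 0 with u_n(0) = u_{n,0}, given explicitly by u_n(t,x) = Σ_{k∈ℤ} û_{n,0}(k) e^{i(kx − h_n k² t)}, one has liminf_{n→∞} ‖u_{n,0}‖_{L²(𝕋)} > 0 while lim_{n→∞} ∫₀ᵀ ∫_ω |u_n(t,x)|² dx dt = 0. -/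
open MeasureTheory Real Filter

noncomputable section

/-- Fourier coefficient `û(k) = (1/2π) ∫_𝕋 u(x) e^{-ikx} dx`. -/
def fc (u : Torus → ℂ) (k : ℤ) : ℂ :=
  (1 / (2 * Real.pi)) * ∫ x : Torus, fourier (-k) x * u x

/-- Spectral characterization of the semiclassical Schrödinger group solving
`ih∂ₜu + h²∂ₓ²u = 0`: `(S(t)u)^(k) = e^{-ihk²t} û(k)`, i.e.
`u(t,x) = Σ_k û₀(k) e^{i(kx - hk²t)}`. -/
def IsSchGroup (h : ℝ) (S : ℝ → L2T →L[ℂ] L2T) : Prop :=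
  ∀ t : ℝ, ∀ u : L2T, ∀ k : ℤ,
    fc (S t u : Torus → ℂ) k =
      Complex.exp (-Complex.I * (h : ℂ) * (k : ℂ) ^ 2 * (t : ℂ)) * fc (u : Torus → ℂ) k

/-- The horizontal observation region `ω = (-π,-α) ∪ (α,π)` viewed inside `𝕋`. -/
def omegaSet (α : ℝ) : Set Torus :=
  (fun x : ℝ => (x : Torus)) '' (Set.Ioo (-Real.pi) (-α) ∪ Set.Ioo α Real.pi)

/-- `fc` is Mathlib's `fourierCoeff` on the circle of length `2π`. -/
lemma fc_eq_fourierCoeff (u : Torus → ℂ) (k : ℤ) : fc u k = fourierCoeff u k := by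
  rw [fc, fourierCoeff, AddCircle.integral_haarAddCircle]
  simp [Complex.real_smul]

lemma fc_congr_ae {u v : Torus → ℂ} (h : u =ᵐ[volume] v) (k : ℤ) : fc u k = fc v k := by
  unfold fc
  congr 1
  refine integral_congr_ae ?_
  filter_upwards [h] with x hx
  rw [hx]

lemma fc_sub (u v : L2T) (k : ℤ) :
    fc ((u - v : L2T) : Torus → ℂ) k = fc (u : Torus → ℂ) k - fc (v : Torus → ℂ) k := by
  have integrable (w : L2T) : Integrable (fun x : Torus => fourier (-k) x * w x) := by
    refine ((Lp.memLp w).integrable one_le_two).bdd_mul (c := 1)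
      (map_continuous (fourier (-k))).aestronglyMeasurable (ae_of_all _ fun x => ?_)
    rw [fourier_apply, Circle.norm_coe]
  rw [fc_congr_ae (Lp.coeFn_sub u v), fc, fc, fc, ← mul_sub,
    ← integral_sub (integrable u) (integrable v)]
  simp [mul_sub]

/-- Parseval's identity for `fc`. -/
lemma hasSum_sq_fc (u : L2T) :
    HasSum (fun k => ‖fc (u : Torus → ℂ) k‖ ^ 2)
      ((2 * Real.pi)⁻¹ * ∫ x : Torus, ‖(u : Torus → ℂ) x‖ ^ 2) := by
  have hu := (Lp.memLp u).haarAddCircle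
  convert hasSum_sq_fourierCoeff hu.toLp using 1
  · funext k
    rw [fc_eq_fourierCoeff, fourierCoeff_congr_ae hu.coeFn_toLp]
  · rw [← smul_eq_mul, ← AddCircle.integral_haarAddCircle]
    refine integral_congr_ae ?_
    filter_upwards [hu.coeFn_toLp] with x hx
    rw [hx]

lemma integrable_norm_sq (u : L2T) : Integrable (fun x : Torus => ‖(u : Torus → ℂ) x‖ ^ 2) :=
  (Lp.memLp u).integrable_norm_pow two_ne_zero

lemma norm_exp_neg_I_mul_sub_one_le_min {θ M : ℝ} (h0 : 0 ≤ θ) (hM : θ ≤ M) :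
    ‖Complex.exp (-Complex.I * θ) - 1‖ ≤ min 2 M := by
  have key : -Complex.I * (θ : ℂ) = Complex.I * ((-θ : ℝ) : ℂ) := by push_cast; ring
  rw [key]
  refine le_min ?_ (norm_exp_I_mul_ofReal_sub_one_le.trans ?_)
  · refine (norm_sub_le _ _).trans ?_
    rw [Complex.norm_exp_I_mul_ofReal, norm_one]
    norm_num
  · rwa [norm_neg, Real.norm_of_nonneg h0]

/-- Majorant for the squared `L²` distance between a solution and its data on `[0, T]`. -/
def deviationBound (T : ℝ) (u : L2T) (h : ℝ) : ℝ :=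
  ∑' k : ℤ, min 2 (h * (k : ℝ) ^ 2 * T) ^ 2 * ‖fc (u : Torus → ℂ) k‖ ^ 2

lemma sq_min_two_le_four {x : ℝ} (hx : 0 ≤ x) : min 2 x ^ 2 ≤ 4 := by
  have h0 : 0 ≤ min 2 x := le_min zero_le_two hx
  nlinarith [min_le_left 2 x]

lemma summable_deviationBound {T h : ℝ} (hT : 0 ≤ T) (hh : 0 ≤ h) (u : L2T) :
    Summable fun k : ℤ => min 2 (h * (k : ℝ) ^ 2 * T) ^ 2 * ‖fc (u : Torus → ℂ) k‖ ^ 2 := by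
  refine ((hasSum_sq_fc u).summable.mul_left 4).of_nonneg_of_le (fun k => by positivity)
    fun k => ?_
  gcongr
  exact sq_min_two_le_four (by positivity)

lemma IsSchGroup.integral_norm_sub_sq_le {h T t : ℝ} {S : ℝ → L2T →L[ℂ] L2T}
    (hS : IsSchGroup h S) (hh : 0 ≤ h) (ht0 : 0 ≤ t) (htT : t ≤ T) (u : L2T) :
    ∫ x : Torus, ‖((S t u - u : L2T) : Torus → ℂ) x‖ ^ 2
      ≤ 2 * Real.pi * deviationBound T u h := by
  have hle : (2 * Real.pi)⁻¹ * ∫ x : Torus, ‖((S t u - u : L2T) : Torus → ℂ) x‖ ^ 2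
      ≤ deviationBound T u h := by
    refine hasSum_le (fun k => ?_) (hasSum_sq_fc (S t u - u))
      (summable_deviationBound (ht0.trans htT) hh u).hasSum
    have hphase : -Complex.I * (h : ℂ) * (k : ℂ) ^ 2 * (t : ℂ)
        = -Complex.I * ((h * (k : ℝ) ^ 2 * t : ℝ) : ℂ) := by push_cast; ring
    rw [fc_sub, hS t u k, ← sub_one_mul, norm_mul, mul_pow, hphase]
    gcongr
    exact norm_exp_neg_I_mul_sub_one_le_min (by positivity) (by gcongr)
  rwa [inv_mul_le_iff₀ (by positivity)] at hle

lemma tendsto_deviationBound {T : ℝ} (hT : 0 ≤ T) (u : L2T) {h : ℕ → ℝ}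
    (h0 : ∀ n, 0 ≤ h n) (hlim : Tendsto h atTop (nhds 0)) :
    Tendsto (fun n => deviationBound T u (h n)) atTop (nhds 0) := by
  have key := tendsto_tsum_of_dominated_convergence (𝓕 := atTop)
    (f := fun n (k : ℤ) => min 2 (h n * (k : ℝ) ^ 2 * T) ^ 2 * ‖fc (u : Torus → ℂ) k‖ ^ 2)
    (g := fun _ => (0 : ℝ)) ((hasSum_sq_fc u).summable.mul_left 4) (fun k => ?_)
    (Eventually.of_forall fun n k => ?_)
  · simpa [deviationBound] using key
  · have hc : Continuous fun s : ℝ =>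
        min 2 (s * (k : ℝ) ^ 2 * T) ^ 2 * ‖fc (u : Torus → ℂ) k‖ ^ 2 := by fun_prop
    simpa [Function.comp_def] using (hc.tendsto 0).comp hlim
  · rw [Real.norm_of_nonneg (by positivity)]
    gcongr
    have := h0 n
    exact sq_min_two_le_four (by positivity)

lemma measurableSet_omegaSet (α : ℝ) : MeasurableSet (omegaSet α) :=
  (QuotientAddGroup.isOpenMap_coe _ (isOpen_Ioo.union isOpen_Ioo)).measurableSet

lemma lt_norm_of_mem_omegaSet {α : ℝ} (hα : 0 < α) {x : Torus} (hx : x ∈ omegaSet α) :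
    α < ‖x‖ := by
  obtain ⟨y, hy, rfl⟩ := hx
  have habs : |y| ≤ |2 * Real.pi| / 2 ∧ α < |y| := by
    rw [abs_of_pos Real.two_pi_pos, mul_div_cancel_left₀ _ two_ne_zero]
    rcases hy with ⟨h1, h2⟩ | ⟨h1, h2⟩
    · rw [abs_of_neg (by linarith)]
      constructor <;> linarith
    · rw [abs_of_pos (by linarith)]
      exact ⟨h2.le, h1⟩
  change α < ‖(y : AddCircle (2 * Real.pi))‖
  rw [(AddCircle.norm_coe_eq_abs_iff (2 * Real.pi) Real.two_pi_pos.ne').mpr habs.1]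
  exact habs.2

/-- The indicator function of the arc `[-α, α]`, as an element of `L²(𝕋)`. -/
def arcIndicator (α : ℝ) : L2T :=
  indicatorConstLp 2 (Metric.isClosed_closedBall (x := (0 : Torus)) (ε := α)).measurableSet
    (measure_ne_top volume _) (1 : ℂ)

lemma norm_arcIndicator_pos {α : ℝ} (hα : 0 < α) : 0 < ‖arcIndicator α‖ := by
  have hpos : 0 < volume (Metric.closedBall (0 : Torus) α) :=
    Metric.measure_closedBall_pos _ _ hα
  rw [arcIndicator, norm_indicatorConstLp two_ne_zero ENNReal.ofNat_ne_top, norm_one, one_mul]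
  exact Real.rpow_pos_of_pos (ENNReal.toReal_pos hpos.ne' (measure_ne_top _ _)) _

lemma arcIndicator_ae_eq_zero_on_omegaSet {α : ℝ} (hα : 0 < α) :
    ∀ᵐ x : Torus, x ∈ omegaSet α → (arcIndicator α : Torus → ℂ) x = 0 := by
  filter_upwards [indicatorConstLp_coeFn (p := 2) (c := (1 : ℂ))
    (hs := (Metric.isClosed_closedBall (x := (0 : Torus)) (ε := α)).measurableSet)
    (hμs := measure_ne_top volume _)] with x hx hxω
  rw [arcIndicator, hx, Set.indicator_of_notMem]
  simpa using lt_norm_of_mem_omegaSet hα hxω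

/-- Data vanishing on a set `s` can put into `s` only as much mass as the solution has moved. -/
lemma setIntegral_norm_sq_le_of_ae_eq_zero {s : Set Torus} (hs : MeasurableSet s) {u v : L2T}
    (hu : ∀ᵐ x : Torus, x ∈ s → (u : Torus → ℂ) x = 0) :
    ∫ x in s, ‖(v : Torus → ℂ) x‖ ^ 2 ≤ ∫ x : Torus, ‖((v - u : L2T) : Torus → ℂ) x‖ ^ 2 := by
  have heq : ∫ x in s, ‖(v : Torus → ℂ) x‖ ^ 2
      = ∫ x in s, ‖((v - u : L2T) : Torus → ℂ) x‖ ^ 2 := by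
    refine setIntegral_congr_ae hs ?_
    filter_upwards [hu, Lp.coeFn_sub v u] with x hx hsub hxs
    rw [hsub, Pi.sub_apply, hx hxs, sub_zero]
  rw [heq]
  exact setIntegral_le_integral (integrable_norm_sq _) (ae_of_all _ fun x => by positivity)

/-- Lemma 5.1, failure of uniform observability for the semiclassical
Schrödinger equation: for `ω = (-π,-α) ∪ (α,π)` and any `T > 0` there are semiclassical
parameters `h_n → 0` and data `u_{n,0} ∈ L²(𝕋)` with `liminf ‖u_{n,0}‖ > 0` whose solutions
`u_n(t) = Σ_k û_{n,0}(k) e^{i(kx - h_n k² t)}` satisfy `∫₀ᵀ∫_ω |u_n|² dx dt → 0`. -/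
theorem no_uniform_observability_semiclassical_schrodinger
    (α : ℝ) (hα0 : 0 < α) (hαπ : α < Real.pi) (T : ℝ) (hT : 0 < T) :
    ∃ hseq : ℕ → ℝ,
      (∀ n, hseq n ∈ Set.Ioo (0:ℝ) 1) ∧
      Tendsto hseq atTop (nhds 0) ∧
      ∃ u0 : ℕ → L2T,
        0 < Filter.liminf (fun n => ‖u0 n‖) atTop ∧
        ∀ Sfam : ℕ → ℝ → L2T →L[ℂ] L2T, (∀ n, IsSchGroup (hseq n) (Sfam n)) →
          Tendsto
            (fun n => ∫ t in (0:ℝ)..T,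
              ∫ x in omegaSet α, ‖(Sfam n t (u0 n) : Torus → ℂ) x‖ ^ 2)
            atTop (nhds 0) := by
  refine ⟨fun n => 1 / ((n : ℝ) + 2), fun n => ⟨by positivity, ?_⟩, ?_,
    fun _ => arcIndicator α, ?_, fun Sfam hS => ?_⟩
  · rw [div_lt_one (by positivity)]
    linarith [n.cast_nonneg (α := ℝ)]
  · exact tendsto_const_nhds.div_atTop (tendsto_natCast_atTop_atTop.atTop_add tendsto_const_nhds)
  · rw [liminf_const]
    exact norm_arcIndicator_pos hα0
  · have hlim := ((tendsto_deviationBound hT.le (arcIndicator α)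
      (h := fun n : ℕ => 1 / ((n : ℝ) + 2)) (fun n => by positivity)
      (tendsto_const_nhds.div_atTop
        (tendsto_natCast_atTop_atTop.atTop_add tendsto_const_nhds))).const_mul
          (2 * Real.pi)).mul_const |T - 0|
    rw [mul_zero, zero_mul] at hlim
    refine squeeze_zero_norm (fun n => ?_) hlim
    refine intervalIntegral.norm_integral_le_of_norm_le_const fun t ht => ?_
    rw [Set.uIoc_of_le hT.le] at ht
    rw [Real.norm_of_nonneg (integral_nonneg fun x => by positivity)]
    exact (setIntegral_norm_sq_le_of_ae_eq_zero (measurableSet_omegaSet α)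
      (arcIndicator_ae_eq_zero_on_omegaSet hα0)).trans
        ((hS n).integral_norm_sub_sq_le (by positivity) ht.1.le ht.2 _)
end
end

section
/- For ε ∈ (0,1] let Gᵉ(x) = ε^{−1/2} e^{−x²/(2ε²)} for x ∈ (−π,π], with Fourier coefficients gᵉ(k) = (1/2π)∫_{−π}^{π} Gᵉ(x) e^{−ikx} dx. Then there exist constants c, C > 0 such that for all ε ∈ (0,1]: (i) c ≤ Σ_{k∈ℤ} |gᵉ(k)|² ≤ C, and (ii) for every real K ≥ 1, Σ_{|k|>K} |gᵉ(k)|² ≤ C/(εK). -/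
open MeasureTheory Real Filter

noncomputable section

/-- The rescaled Gaussian `Gᵉ(x) = ε^{-1/2} e^{-x²/(2ε²)}`. -/
def gaussScaled (ε : ℝ) (x : ℝ) : ℝ := ε ^ (-(1:ℝ)/2) * Real.exp (-x ^ 2 / (2 * ε ^ 2))

/-- Its `k`-th Fourier coefficient on `(-π,π]`:
`gᵉ(k) = (1/2π) ∫_{-π}^{π} Gᵉ(x) e^{-ikx} dx`. -/
def gaussScaledCoeff (ε : ℝ) (k : ℤ) : ℂ :=
  ((1 / (2 * Real.pi) : ℝ) : ℂ) *
    ∫ x in (-Real.pi)..Real.pi,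
      ((gaussScaled ε x : ℝ) : ℂ) * Complex.exp (-Complex.I * (k : ℂ) * (x : ℂ))

theorem neg_pi_lt_pi : -π < π := by linarith [pi_pos]

/-- Parseval's identity on `(-π, π]` for a continuous function. -/
theorem Continuous.hasSum_sq_fourierCoeffOn_pi {f : ℝ → ℂ} (hf : Continuous f) :
    HasSum (fun k : ℤ => ‖fourierCoeffOn neg_pi_lt_pi f k‖ ^ 2)
      ((2 * π)⁻¹ * ∫ x in (-π)..π, ‖f x‖ ^ 2) := by
  have hL2 : MemLp f 2 (volume.restrict (Set.Ioc (-π) π)) := by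
    obtain ⟨B, hB⟩ := (isCompact_Icc (a := -π) (b := π)).exists_bound_of_continuousOn
      hf.continuousOn
    refine MemLp.of_bound hf.aestronglyMeasurable B ?_
    filter_upwards [ae_restrict_mem measurableSet_Ioc] with x hx
    exact hB x (Set.Ioc_subset_Icc_self hx)
  have h := hasSum_sq_fourierCoeffOn neg_pi_lt_pi hL2
  rwa [smul_eq_mul, show π - -π = 2 * π by ring] at h

theorem gaussScaledCoeff_eq_fourierCoeffOn (ε : ℝ) (k : ℤ) :
    gaussScaledCoeff ε k =
      fourierCoeffOn neg_pi_lt_pi (fun x => ((gaussScaled ε x : ℝ) : ℂ)) k := by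
  rw [fourierCoeffOn_eq_integral, gaussScaledCoeff, show π - -π = 2 * π by ring,
    Complex.real_smul]
  congr 1
  refine intervalIntegral.integral_congr fun x _ => ?_
  simp only [smul_eq_mul]
  rw [mul_comm, fourier_coe_apply]
  congr 2
  have : (π : ℂ) ≠ 0 := by exact_mod_cast pi_ne_zero
  push_cast
  field_simp

theorem hasDerivAt_gaussScaled {ε : ℝ} (hε : ε ≠ 0) (x : ℝ) :
    HasDerivAt (gaussScaled ε) (-(x / ε ^ 2) * gaussScaled ε x) x := by
  have h : HasDerivAt (fun y : ℝ => -y ^ 2 / (2 * ε ^ 2)) (-(x / ε ^ 2)) x := by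
    refine ((hasDerivAt_pow 2 x).neg.div_const (2 * ε ^ 2)).congr_deriv ?_
    field_simp
    norm_num
  refine (h.exp.const_mul (ε ^ (-(1 : ℝ) / 2))).congr_deriv ?_
  simp only [gaussScaled]
  ring

theorem continuous_gaussScaled (ε : ℝ) : Continuous (gaussScaled ε) := by
  unfold gaussScaled
  fun_prop

theorem gaussScaled_sq {ε : ℝ} (hε : 0 < ε) (x : ℝ) :
    gaussScaled ε x ^ 2 = ε⁻¹ * Real.exp (-(1 / ε ^ 2) * x ^ 2) := by
  rw [gaussScaled, mul_pow, ← Real.rpow_natCast, ← Real.rpow_mul hε.le, ← Real.exp_nat_mul,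
    ← Real.rpow_neg_one]
  congr 2
  · norm_num
  · field_simp
    push_cast
    ring

/-- The derivative of the rescaled Gaussian has Fourier coefficients `i k gᵉ(k)`. -/
theorem norm_fourierCoeffOn_deriv_gaussScaled {ε : ℝ} (hε : ε ≠ 0) {k : ℤ} (hk : k ≠ 0) :
    ‖fourierCoeffOn neg_pi_lt_pi
      (fun x => ((-(x / ε ^ 2) * gaussScaled ε x : ℝ) : ℂ)) k‖ =
      |(k : ℝ)| * ‖gaussScaledCoeff ε k‖ := by
  have hc := continuous_gaussScaled ε
  have hcont : Continuous fun x : ℝ => ((-(x / ε ^ 2) * gaussScaled ε x : ℝ) : ℂ) := by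
    fun_prop
  have heven : gaussScaled ε (-π) = gaussScaled ε π := by simp [gaussScaled]
  have h := fourierCoeffOn_of_hasDerivAt neg_pi_lt_pi hk
    (fun x _ => (hasDerivAt_gaussScaled hε x).ofReal_comp) (hcont.intervalIntegrable _ _)
  rw [← gaussScaledCoeff_eq_fourierCoeffOn, heven, sub_self, mul_zero, zero_sub] at h
  have hk' : |(k : ℝ)| ≠ 0 := by simpa using hk
  have hπ : (π : ℝ) ≠ 0 := pi_ne_zero
  have h2 : ((π : ℂ) - ((-π : ℝ) : ℂ)) = ((2 * π : ℝ) : ℂ) := by push_cast; ring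
  rw [h, h2]
  simp only [norm_mul, norm_div, norm_neg, norm_one, Complex.norm_real, Complex.norm_I,
    Complex.norm_intCast, Real.norm_eq_abs, abs_of_pos pi_pos, Complex.norm_ofNat,
    Nat.abs_ofNat]
  field_simp

theorem intervalIntegral_gaussian_le {b : ℝ} (hb : 0 < b) :
    ∫ x in (-π)..π, Real.exp (-b * x ^ 2) ≤ √(π / b) := by
  rw [intervalIntegral.integral_of_le neg_pi_lt_pi.le, ← integral_gaussian]
  exact setIntegral_le_integral (integrable_exp_neg_mul_sq hb)
    (Eventually.of_forall fun x => (Real.exp_pos _).le)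

theorem intervalIntegral_gaussScaled_sq_le {ε : ℝ} (hε : 0 < ε) :
    ∫ x in (-π)..π, gaussScaled ε x ^ 2 ≤ √π := by
  simp_rw [gaussScaled_sq hε]
  rw [intervalIntegral.integral_const_mul]
  have h := intervalIntegral_gaussian_le (b := 1 / ε ^ 2) (by positivity)
  rw [div_div_eq_mul_div, div_one, Real.sqrt_mul pi_pos.le, Real.sqrt_sq hε.le] at h
  calc _ ≤ ε⁻¹ * (√π * ε) := by gcongr
    _ = √π := by field_simp

theorem le_intervalIntegral_gaussScaled_sq {ε : ℝ} (hε : 0 < ε) (hε1 : ε ≤ 1) :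
    2 * Real.exp (-1) ≤ ∫ x in (-π)..π, gaussScaled ε x ^ 2 := by
  have hc := continuous_gaussScaled ε
  have hπ := pi_gt_three
  calc 2 * Real.exp (-1) = ∫ _ in (-ε)..ε, ε⁻¹ * Real.exp (-1) := by
        rw [intervalIntegral.integral_const, smul_eq_mul]
        field_simp
        ring
    _ ≤ ∫ x in (-ε)..ε, gaussScaled ε x ^ 2 := by
        refine intervalIntegral.integral_mono_on (by linarith) (by simp)
          ((hc.pow 2).intervalIntegrable _ _) fun x hx => ?_
        rw [gaussScaled_sq hε]
        gcongr
        have : x ^ 2 ≤ ε ^ 2 := sq_le_sq' hx.1 hx.2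
        rw [neg_mul, neg_le_neg_iff, one_div_mul_eq_div]
        exact (div_le_one (by positivity)).2 this
    _ ≤ ∫ x in (-π)..π, gaussScaled ε x ^ 2 :=
        intervalIntegral.integral_mono_interval (by linarith) (by linarith) (by linarith)
          (Eventually.of_forall fun x => sq_nonneg _) ((hc.pow 2).intervalIntegrable _ _)

theorem intervalIntegral_deriv_gaussScaled_sq_le {ε : ℝ} (hε : 0 < ε) :
    ∫ x in (-π)..π, (-(x / ε ^ 2) * gaussScaled ε x) ^ 2 ≤ 2 * √(2 * π) / ε ^ 2 := by
  have hc := continuous_gaussScaled ε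
  have hpt : ∀ x : ℝ, (-(x / ε ^ 2) * gaussScaled ε x) ^ 2 ≤
      2 / ε ^ 3 * Real.exp (-(1 / (2 * ε ^ 2)) * x ^ 2) := by
    intro x
    have hexp : Real.exp (-(1 / ε ^ 2) * x ^ 2) =
        Real.exp (-(1 / (2 * ε ^ 2)) * x ^ 2) * Real.exp (-(x ^ 2 / (2 * ε ^ 2))) := by
      rw [← Real.exp_add]
      congr 1
      field_simp
      ring
    have hle : x ^ 2 / (2 * ε ^ 2) * Real.exp (-(x ^ 2 / (2 * ε ^ 2))) ≤ 1 := by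
      rw [Real.exp_neg, ← div_eq_mul_inv]
      refine (div_le_one (Real.exp_pos _)).2 ?_
      linarith [Real.add_one_le_exp (x ^ 2 / (2 * ε ^ 2))]
    rw [mul_pow, gaussScaled_sq hε, hexp]
    calc _ = 2 / ε ^ 3 * Real.exp (-(1 / (2 * ε ^ 2)) * x ^ 2) *
          (x ^ 2 / (2 * ε ^ 2) * Real.exp (-(x ^ 2 / (2 * ε ^ 2)))) := by
          field_simp
      _ ≤ _ := mul_le_of_le_one_right (by positivity) hle
  have h := intervalIntegral_gaussian_le (b := 1 / (2 * ε ^ 2)) (by positivity)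
  rw [div_div_eq_mul_div, div_one, show π * (2 * ε ^ 2) = 2 * π * ε ^ 2 by ring,
    Real.sqrt_mul (by positivity), Real.sqrt_sq hε.le] at h
  calc _ ≤ ∫ x in (-π)..π, 2 / ε ^ 3 * Real.exp (-(1 / (2 * ε ^ 2)) * x ^ 2) :=
        intervalIntegral.integral_mono_on neg_pi_lt_pi.le
          (Continuous.intervalIntegrable (by fun_prop) _ _)
          (Continuous.intervalIntegrable (by fun_prop) _ _) fun x _ => hpt x
    _ ≤ 2 / ε ^ 3 * (√(2 * π) * ε) := by
        rw [intervalIntegral.integral_const_mul]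
        gcongr
    _ = _ := by field_simp

theorem hasSum_sq_gaussScaledCoeff (ε : ℝ) :
    HasSum (fun k : ℤ => ‖gaussScaledCoeff ε k‖ ^ 2)
      ((2 * π)⁻¹ * ∫ x in (-π)..π, gaussScaled ε x ^ 2) := by
  have h := (Complex.continuous_ofReal.comp
    (continuous_gaussScaled ε)).hasSum_sq_fourierCoeffOn_pi
  simpa only [Function.comp_def, ← gaussScaledCoeff_eq_fourierCoeffOn, Complex.norm_real,
    Real.norm_eq_abs, sq_abs] using h

theorem tsum_sq_gaussScaledCoeff_le_one {ε : ℝ} (hε : 0 < ε) :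
    ∑' k : ℤ, ‖gaussScaledCoeff ε k‖ ^ 2 ≤ 1 := by
  rw [(hasSum_sq_gaussScaledCoeff ε).tsum_eq, inv_mul_le_one₀ (by positivity)]
  have h : √π ≤ π := by
    rw [Real.sqrt_le_left pi_pos.le]
    nlinarith [pi_gt_three]
  linarith [intervalIntegral_gaussScaled_sq_le hε, pi_pos]

/-- Chebyshev's inequality for the Fourier coefficients, from Parseval for the derivative. -/
theorem tsum_sq_gaussScaledCoeff_tail_le {ε K : ℝ} (hε : 0 < ε) (hK : 0 < K) :
    (∑' k : ℤ, if K < |(k : ℝ)| then ‖gaussScaledCoeff ε k‖ ^ 2 else 0) ≤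
      1 / (ε * K) ^ 2 := by
  have hc := continuous_gaussScaled ε
  have hcont : Continuous fun x : ℝ => ((-(x / ε ^ 2) * gaussScaled ε x : ℝ) : ℂ) := by
    fun_prop
  have hP := hcont.hasSum_sq_fourierCoeffOn_pi.mul_left (K ^ 2)⁻¹
  simp only [Complex.norm_real, Real.norm_eq_abs, sq_abs] at hP
  have hterm : ∀ k : ℤ, (if K < |(k : ℝ)| then ‖gaussScaledCoeff ε k‖ ^ 2 else 0) ≤
      (K ^ 2)⁻¹ * ‖fourierCoeffOn neg_pi_lt_pi
        (fun x => ((-(x / ε ^ 2) * gaussScaled ε x : ℝ) : ℂ)) k‖ ^ 2 := by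
    intro k
    split_ifs with h
    · have hk : k ≠ 0 := by
        rintro rfl
        simp at h
        linarith
      rw [norm_fourierCoeffOn_deriv_gaussScaled hε.ne' hk, mul_pow, ← mul_assoc]
      refine le_mul_of_one_le_left (sq_nonneg _) ?_
      rw [inv_mul_eq_div]
      refine (one_le_div (by positivity)).2 ?_
      gcongr
    · positivity
  have hsum : Summable fun k : ℤ =>
      if K < |(k : ℝ)| then ‖gaussScaledCoeff ε k‖ ^ 2 else 0 :=
    hP.summable.of_nonneg_of_le (fun k => by positivity) hterm
  have hsqrt : √(2 * π) ≤ π := by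
    rw [Real.sqrt_le_left pi_pos.le]
    nlinarith [pi_gt_three]
  calc _ ≤ _ := hasSum_le hterm hsum.hasSum hP
    _ ≤ (K ^ 2)⁻¹ * ((2 * π)⁻¹ * (2 * π / ε ^ 2)) := by
        gcongr
        exact (intervalIntegral_deriv_gaussScaled_sq_le hε).trans (by gcongr)
    _ = _ := by field_simp

/-- mass estimates for the Gaussian Fourier coefficients: uniformly in
`ε ∈ (0,1]`, the total mass `Σ_k |gᵉ(k)|²` is bounded above and below, and the tail mass
beyond frequency `K` is at most `C/(εK)`. -/
theorem gaussScaledCoeff_mass_bounds :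
    ∃ c C : ℝ, 0 < c ∧ 0 < C ∧
      ∀ ε : ℝ, ε ∈ Set.Ioc (0:ℝ) 1 →
        (c ≤ ∑' k : ℤ, ‖gaussScaledCoeff ε k‖ ^ 2) ∧
        (∑' k : ℤ, ‖gaussScaledCoeff ε k‖ ^ 2 ≤ C) ∧
        ∀ K : ℝ, 1 ≤ K →
          (∑' k : ℤ, if K < |(k : ℝ)| then ‖gaussScaledCoeff ε k‖ ^ 2 else 0) ≤
            C / (ε * K) := by
  refine ⟨(2 * π)⁻¹ * (2 * Real.exp (-1)), 1, by positivity, one_pos, ?_⟩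
  rintro ε ⟨hε, hε1⟩
  refine ⟨?_, tsum_sq_gaussScaledCoeff_le_one hε, fun K hK => ?_⟩
  · rw [(hasSum_sq_gaussScaledCoeff ε).tsum_eq]
    gcongr
    exact le_intervalIntegral_gaussScaled_sq hε hε1
  have hK0 : 0 < K := by linarith
  have hεK : 0 < ε * K := by positivity
  rcases le_total 1 (ε * K) with h | h
  · refine (tsum_sq_gaussScaledCoeff_tail_le hε hK0).trans ?_
    gcongr
    exact le_self_pow₀ h two_ne_zero
  · have hsum := (hasSum_sq_gaussScaledCoeff ε).summable
    have hterm : ∀ k : ℤ, (if K < |(k : ℝ)| then ‖gaussScaledCoeff ε k‖ ^ 2 else 0) ≤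
        ‖gaussScaledCoeff ε k‖ ^ 2 := by
      intro k
      split_ifs <;> simp
    calc _ ≤ ∑' k : ℤ, ‖gaussScaledCoeff ε k‖ ^ 2 :=
          (hsum.of_nonneg_of_le (fun k => by positivity) hterm).tsum_le_tsum hterm hsum
      _ ≤ 1 := tsum_sq_gaussScaledCoeff_le_one hε
      _ ≤ 1 / (ε * K) := (one_le_div hεK).2 h
end
end

section
/- Let g : 𝕋 → ℝ be continuous with g ≥ 0, with Fourier coefficients ĝ(l) = ∫_𝕋 g(x)e^{−ilx}dx satisfying ĝ(0) = ∫_𝕋 g = 1, and suppose g > 0 on some nonempty open interval of 𝕋. Then there exists c₀ > 0 such that for every l ∈ ℤ with l ≠ 0, c_l := Σ_{j∈ℤ} |ĝ(j−l) − ĝ(j)ĝ(l)|² ≥ c₀. -/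
open MeasureTheory Real Filter

noncomputable section

/-- Fourier coefficient with the paper's normalization `ĝ(l) = ∫_𝕋 g(x) e^{-ilx} dx`. -/
def ghat (g : Torus → ℝ) (l : ℤ) : ℂ :=
  ∫ x : Torus, fourier (-l) x * (g x : ℂ)

/-- `ghat g` is `2π` times the Fourier coefficient with respect to normalised Haar measure. -/
lemma ghat_eq_fourierCoeff (g : Torus → ℝ) (l : ℤ) :
    ghat g l = (2 * π) • fourierCoeff (fun x : Torus => (g x : ℂ)) l := by
  rw [fourierCoeff, AddCircle.integral_haarAddCircle, smul_smul,
    mul_inv_cancel₀ (by positivity), one_smul]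
  rfl

/-- Bessel's inequality in qualitative form: the Fourier coefficients are square summable. -/
lemma summable_norm_sq_ghat {g : Torus → ℝ} (hg : Continuous g) :
    Summable fun l => ‖ghat g l‖ ^ 2 := by
  let f : C(Torus, ℂ) := ⟨fun x => (g x : ℂ), by fun_prop⟩
  have h := (hasSum_sq_fourierCoeff
    (ContinuousMap.toLp (E := ℂ) 2 AddCircle.haarAddCircle ℂ f)).summable
  simp_rw [fourierCoeff_toLp] at h
  refine (h.mul_left ((2 * π) ^ 2)).congr fun l => ?_
  rw [ghat_eq_fourierCoeff, norm_smul, mul_pow _ ‖_‖, Real.norm_eq_abs, sq_abs]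
  rfl

lemma summable_norm_sq_sub {ι : Type*} {a b : ι → ℂ} (ha : Summable fun i => ‖a i‖ ^ 2)
    (hb : Summable fun i => ‖b i‖ ^ 2) : Summable fun i => ‖a i - b i‖ ^ 2 := by
  refine Summable.of_nonneg_of_le (fun _ => by positivity) (fun i => ?_)
    ((ha.add hb).mul_left 2)
  nlinarith [pow_le_pow_left₀ (norm_nonneg _) (norm_sub_le (a i) (b i)) 2,
    sq_nonneg (‖a i‖ - ‖b i‖)]

/-- A nonconstant character of the torus is not constant on any nonempty open set. -/
lemma not_forall_mem_fourier_eq {n : ℤ} (hn : n ≠ 0) {U : Set Torus} (hU : IsOpen U)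
    (hne : U.Nonempty) (u : ℂ) : ¬ ∀ x ∈ U, fourier n x = u := by
  intro h
  obtain ⟨x, hx⟩ := hne
  obtain ⟨t, rfl⟩ := QuotientAddGroup.mk_surjective x
  have hev : (fun y : ℝ => fourier n (y : Torus)) =ᶠ[nhds t] fun _ => u := by
    have hcont : Continuous fun y : ℝ => (y : Torus) := AddCircle.continuous_mk' _
    filter_upwards [(hU.preimage hcont).mem_nhds hx] with y hy using h _ hy
  have h0 := (hasDerivAt_fourier (2 * π) n t).unique
    ((hasDerivAt_const t u).congr_of_eventuallyEq hev)
  have hpi : (π : ℂ) ≠ 0 := by exact_mod_cast Real.pi_ne_zero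
  have hn' : (n : ℂ) ≠ 0 := by exact_mod_cast hn
  simp [hpi, hn', Complex.I_ne_zero] at h0

lemma norm_fourier_apply (n : ℤ) (x : Torus) : ‖fourier n x‖ = 1 := by
  rw [fourier_apply]; exact Circle.norm_coe _

lemma integral_eq_one_of_ghat_zero {g : Torus → ℝ} (h : ghat g 0 = 1) : ∫ x, g x = 1 := by
  simp only [ghat, neg_zero, fourier_zero, one_mul] at h
  rw [integral_complex_ofReal] at h
  exact_mod_cast h

lemma norm_ghat_lt_one {g : Torus → ℝ} (hg_cont : Continuous g) (hg_nonneg : ∀ x, 0 ≤ g x)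
    (hg_mean : ghat g 0 = 1) {U : Set Torus} (hU : IsOpen U) (hne : U.Nonempty)
    (hpos : ∀ x ∈ U, 0 < g x) {l : ℤ} (hl : l ≠ 0) : ‖ghat g l‖ < 1 := by
  have hint := integral_eq_one_of_ghat_zero hg_mean
  have hnorm (x : Torus) : ‖fourier (-l) x * (g x : ℂ)‖ = g x := by
    rw [norm_mul, norm_fourier_apply, one_mul, Complex.norm_real, Real.norm_of_nonneg (hg_nonneg x)]
  have hle : ‖ghat g l‖ ≤ 1 :=
    (norm_integral_le_integral_norm _).trans_eq (by simp_rw [hnorm]; exact hint)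
  refine hle.lt_of_ne fun heq => ?_
  set u := ghat g l
  have hcont : Continuous fun x : Torus => (starRingEnd ℂ) u * (fourier (-l) x * (g x : ℂ)) := by
    fun_prop
  have hInt {E : Type} [NormedAddCommGroup E] {f : Torus → E} (hf : Continuous f) :
      Integrable f := hf.integrable_of_hasCompactSupport (HasCompactSupport.of_compactSpace f)
  have hre : ∫ x : Torus, ((starRingEnd ℂ) u * (fourier (-l) x * (g x : ℂ))).re = 1 := by
    have h := integral_re (𝕜 := ℂ) (hInt hcont)
    simp only [RCLike.re_eq_complex_re] at h
    rw [h, integral_const_mul]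
    change ((starRingEnd ℂ) u * u).re = 1
    rw [← Complex.normSq_eq_conj_mul_self, Complex.ofReal_re, Complex.normSq_eq_norm_sq, heq,
      one_pow]
  have hle_re (x : Torus) : ((starRingEnd ℂ) u * (fourier (-l) x * (g x : ℂ))).re ≤ g x := by
    refine (Complex.re_le_norm _).trans_eq ?_
    rw [norm_mul, hnorm, RCLike.norm_conj, heq, one_mul]
  have hcont_re : Continuous fun x : Torus =>
      ((starRingEnd ℂ) u * (fourier (-l) x * (g x : ℂ))).re := Complex.continuous_re.comp hcont
  have hzero : ∫ x : Torus, (g x - ((starRingEnd ℂ) u * (fourier (-l) x * (g x : ℂ))).re) = 0 := by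
    rw [integral_sub (hInt hg_cont) (hInt hcont_re), hre, hint, sub_self]
  have hfun := ((hg_cont.sub hcont_re).ae_eq_iff_eq volume continuous_const).1
    ((integral_eq_zero_iff_of_nonneg (fun x => sub_nonneg.2 (hle_re x))
      (hInt (hg_cont.sub hcont_re))).1 hzero)
  refine not_forall_mem_fourier_eq (neg_ne_zero.2 hl) hU hne u fun x hx => ?_
  have hx0 := congrFun hfun x
  have hval : ((starRingEnd ℂ) u * fourier (-l) x).re = 1 := by
    have hfactor : ((starRingEnd ℂ) u * (fourier (-l) x * (g x : ℂ))).re =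
        ((starRingEnd ℂ) u * fourier (-l) x).re * g x := by
      rw [← mul_assoc, Complex.re_mul_ofReal]
    have hx1 : g x - ((starRingEnd ℂ) u * (fourier (-l) x * (g x : ℂ))).re = 0 := hx0
    rw [hfactor] at hx1
    exact mul_right_cancel₀ (hpos x hx).ne' (by linarith)
  have hdist : ‖fourier (-l) x - u‖ ^ 2 = 0 := by
    have hsq := congrArg (· ^ 2) (norm_fourier_apply (-l) x)
    have hsq' := congrArg (· ^ 2) heq
    simp only [← Complex.normSq_eq_norm_sq, Complex.normSq_apply] at hsq hsq' ⊢
    simp only [Complex.mul_re, Complex.conj_re, Complex.conj_im] at hval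
    simp only [Complex.sub_re, Complex.sub_im]
    linarith
  exact sub_eq_zero.1 (norm_eq_zero.1 (pow_eq_zero_iff two_ne_zero |>.1 hdist))

/-- A function tending to a positive limit along `cofinite` and positive
on `s` is bounded below on `s` by a positive constant. -/
lemma exists_pos_le_of_tendsto_cofinite {ι : Type*} {f : ι → ℝ} {a : ℝ} {s : Set ι}
    (hf : Tendsto f cofinite (nhds a)) (ha : 0 < a) (hs : ∀ i ∈ s, 0 < f i) :
    ∃ c, 0 < c ∧ ∀ i ∈ s, c ≤ f i := by
  have hfin : {i | ¬ a / 2 < f i}.Finite :=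
    hf.eventually (lt_mem_nhds (half_lt_self ha))
  have hfin' := hfin.inter_of_left s
  rcases ({i | ¬ a / 2 < f i} ∩ s).eq_empty_or_nonempty with hempty | hnon
  · refine ⟨a / 2, half_pos ha, fun i hi => ?_⟩
    by_contra! hlt
    exact (hempty ▸ (⟨not_lt.2 hlt.le, hi⟩ : i ∈ {i | ¬ a / 2 < f i} ∩ s) : i ∈ (∅ : Set ι))
  · obtain ⟨m, hm, hmin⟩ := Set.exists_min_image _ f hfin' hnon
    refine ⟨f m, hs m hm.2, fun i hi => ?_⟩
    by_cases hi' : a / 2 < f i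
    · exact (not_lt.1 hm.1).trans hi'.le
    · exact hmin i ⟨hi', hi⟩

/-- lower bound on the coefficients `c_l` in the proof of Proposition 3.6:
if `g ≥ 0` is continuous with `ĝ(0) = 1` and positive on some nonempty open interval, then
`c_l = Σ_j |ĝ(j-l) - ĝ(j)ĝ(l)|²` is bounded below uniformly in `l ≠ 0`. -/
theorem coefficient_lower_bound
    (g : Torus → ℝ) (hg_cont : Continuous g) (hg_nonneg : ∀ x, 0 ≤ g x)
    (hg_mean : ghat g 0 = 1)
    (hg_pos : ∃ U : Set Torus, IsOpen U ∧ U.Nonempty ∧ ∀ x ∈ U, 0 < g x) :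
    ∃ c₀ : ℝ, 0 < c₀ ∧
      ∀ l : ℤ, l ≠ 0 →
        c₀ ≤ ∑' j : ℤ, ‖ghat g (j - l) - ghat g j * ghat g l‖ ^ 2 := by
  obtain ⟨U, hU, hne, hpos⟩ := hg_pos
  have hsum := summable_norm_sq_ghat hg_cont
  have hlim : Tendsto (fun l => (1 - ‖ghat g l‖ ^ 2) ^ 2) cofinite (nhds 1) := by
    simpa using (hsum.tendsto_cofinite_zero.const_sub 1).pow 2
  obtain ⟨c, hc, hle⟩ := exists_pos_le_of_tendsto_cofinite (s := {0}ᶜ) hlim one_pos fun l hl => by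
    have hlt := norm_ghat_lt_one hg_cont hg_nonneg hg_mean hU hne hpos (l := l) hl
    exact pow_pos (sub_pos.2 (pow_lt_one₀ (norm_nonneg _) hlt two_ne_zero)) 2
  refine ⟨c, hc, fun l hl => (hle l hl).trans ?_⟩
  have hshift : Summable fun j => ‖ghat g (j - l)‖ ^ 2 :=
    (Equiv.subRight l).summable_iff.2 hsum
  have hmul : Summable fun j => ‖ghat g j * ghat g l‖ ^ 2 := by
    simpa only [norm_mul, mul_pow] using hsum.mul_right (‖ghat g l‖ ^ 2)
  refine le_trans ?_ ((summable_norm_sq_sub hshift hmul).le_tsum l fun _ _ => by positivity)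
  rw [sub_self, hg_mean, ← pow_two]
  have hone : ‖ghat g l‖ ≤ 1 :=
    (norm_ghat_lt_one hg_cont hg_nonneg hg_mean hU hne hpos hl).le
  refine pow_le_pow_left₀ (sub_nonneg.2 (pow_le_one₀ (norm_nonneg _) hone)) ?_ 2
  rw [← norm_pow]
  simpa only [norm_one] using norm_sub_norm_le (1 : ℂ) (ghat g l ^ 2)
end
end

section
/- Let g : 𝕋 → ℝ be continuous with g ≥ 0 and g > 0 on some nonempty open interval, and let c₀ > 0. Then there exist T₀ > 0 and c₁ > 0, depending only on g and c₀, such that for every real v with |v| ≥ c₀ and every x₀ ∈ 𝕋, ∫₀^{T₀} g(x₀ − vt)² dt ≥ c₁. -/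
open MeasureTheory Real Filter

noncomputable section

/-- A line traversed at speed `w ≥ c` during the time `T / c` winds at least `w / (2 * c)` full
times around the circle of length `T`. -/
theorem AddCircle.integral_div_le_intervalIntegral_comp_mul {T : ℝ} [hT : Fact (0 < T)]
    {h : AddCircle T → ℝ} (hc : Continuous h) (h0 : ∀ x, 0 ≤ h x) {c w : ℝ} (hc0 : 0 < c)
    (hw : c ≤ w) :
    (∫ x, h x) / (2 * c) ≤ ∫ t in (0:ℝ)..T / c, h ((w * t : ℝ) : AddCircle T) := by
  have hTpos : 0 < T := hT.out
  have hw0 : 0 < w := hc0.trans_le hw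
  have hcont : Continuous fun s : ℝ => h (s : AddCircle T) :=
    hc.comp (AddCircle.continuous_mk' T)
  have hper : Function.Periodic (fun s : ℝ => h (s : AddCircle T)) T := fun s => by simp
  have hone : 1 ≤ w / c := (one_le_div hc0).2 hw
  have hfloor : (1 : ℤ) ≤ ⌊w / c⌋ := Int.le_floor.2 (by simpa using hone)
  have hfloor' : (1 : ℝ) ≤ ⌊w / c⌋ := by exact_mod_cast hfloor
  have hhalf : w / c / 2 ≤ ⌊w / c⌋ := by linarith [Int.lt_floor_add_one (w / c)]
  have hI : 0 ≤ ∫ x, h x := integral_nonneg h0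
  have hwind : ∫ s in (0:ℝ)..⌊w / c⌋ • T, h (s : AddCircle T) = ⌊w / c⌋ * ∫ x, h x := by
    have key := hper.intervalIntegral_add_zsmul_eq ⌊w / c⌋ 0
      (fun _ _ => hcont.intervalIntegrable _ _)
    rw [AddCircle.intervalIntegral_preimage T 0 h] at key
    simpa using key
  have hle : (⌊w / c⌋ : ℝ) * T ≤ w * (T / c) := by
    calc (⌊w / c⌋ : ℝ) * T ≤ w / c * T := by gcongr; exact Int.floor_le _
      _ = w * (T / c) := by ring
  have hmono : ∫ s in (0:ℝ)..⌊w / c⌋ • T, h (s : AddCircle T) ≤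
      ∫ s in (0:ℝ)..w * (T / c), h (s : AddCircle T) := by
    refine intervalIntegral.integral_mono_interval le_rfl ?_ ?_
      (ae_of_all _ fun s => h0 _) (hcont.intervalIntegrable _ _)
    · rw [zsmul_eq_mul]; positivity
    · rwa [zsmul_eq_mul]
  rw [intervalIntegral.integral_comp_mul_left (fun s : ℝ => h (s : AddCircle T)) hw0.ne',
    mul_zero, smul_eq_mul]
  calc (∫ x, h x) / (2 * c) = w⁻¹ * (w / c / 2 * ∫ x, h x) := by field_simp
    _ ≤ w⁻¹ * (⌊w / c⌋ * ∫ x, h x) := by gcongr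
    _ ≤ w⁻¹ * ∫ s in (0:ℝ)..w * (T / c), h (s : AddCircle T) := by
      rw [← hwind]; gcongr

/-- averaged observability along the transport flow: if `g ≥ 0` is
continuous and positive on some nonempty open interval of `𝕋`, then for every `c₀ > 0` there
are `T₀ > 0` and `c₁ > 0` such that `∫₀^{T₀} g(x₀ - vt)² dt ≥ c₁` for every speed `|v| ≥ c₀`
and every starting point `x₀ ∈ 𝕋`. -/
theorem transport_observability
    (g : Torus → ℝ) (hg_cont : Continuous g) (hg_nonneg : ∀ x, 0 ≤ g x)
    (hg_pos : ∃ U : Set Torus, IsOpen U ∧ U.Nonempty ∧ ∀ x ∈ U, 0 < g x)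
    (c₀ : ℝ) (hc₀ : 0 < c₀) :
    ∃ T₀ : ℝ, 0 < T₀ ∧ ∃ c₁ : ℝ, 0 < c₁ ∧
      ∀ v : ℝ, c₀ ≤ |v| → ∀ x₀ : Torus,
        c₁ ≤ ∫ t in (0:ℝ)..T₀, g (x₀ - ((v * t : ℝ) : Torus)) ^ 2 := by
  obtain ⟨U, -, ⟨y, hy⟩, hU⟩ := hg_pos
  have hcont : Continuous fun x => g x ^ 2 := hg_cont.pow 2
  have hI : 0 < ∫ x, g x ^ 2 :=
    hcont.integral_pos_of_hasCompactSupport_nonneg_nonzero (HasCompactSupport.of_compactSpace _)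
      (fun x => sq_nonneg (g x)) (pow_pos (hU y hy) 2).ne'
  refine ⟨2 * Real.pi / c₀, by positivity, (∫ x, g x ^ 2) / (2 * c₀), by positivity,
    fun v hv x₀ => ?_⟩
  rcases le_total 0 v with hv0 | hv0
  · rw [abs_of_nonneg hv0] at hv
    have key := AddCircle.integral_div_le_intervalIntegral_comp_mul
      (h := fun x : Torus => g (x₀ - x) ^ 2) (by fun_prop) (fun x => sq_nonneg _) hc₀ hv
    rwa [integral_sub_left_eq_self (fun x => g x ^ 2) volume x₀] at key
  · rw [abs_of_nonpos hv0] at hv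
    have key := AddCircle.integral_div_le_intervalIntegral_comp_mul
      (h := fun x : Torus => g (x₀ + x) ^ 2) (by fun_prop) (fun x => sq_nonneg _) hc₀ hv
    rw [integral_add_left_eq_self (fun x => g x ^ 2) x₀] at key
    simpa only [neg_mul, AddCircle.coe_neg, ← sub_eq_add_neg] using key
end
end
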